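/- Let H ∈ (0,1/2), let W^H be a fractional Brownian motion with Hurst parameter H, and let X^H be a continuous process adapted to the natural filtration of W^H satisfying the fractional Ornstein–Uhlenbeck equation X^H_t = x₀ + ρ ∫₀ᵗ (μ − X^H_s) ds + W^H_t for all t ∈ [0,1], where x₀, μ ∈ ℝ and ρ ≥ 0. Define the integrated variance Y_t := ∫₀ᵗ exp(2 X^H_s) ds. Fix m ∈ ℕ, α₀ > 0 and α₁,…,α_m ≥ 0. Then, with probability one, |𝓡^s_n(Y) − H| = O(√n · 2^{−Hn/2}) as n → ∞. -/

import Mathlib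

open MeasureTheory ProbabilityTheory Filter

/-- Approximated Faber–Schauder coefficient `ϑ^f_{n,k}`. -/
noncomputable def vartheta (f : ℝ → ℝ) (n k : ℕ) : ℝ :=
  (2 : ℝ) ^ ((3 * (n : ℝ)) / 2 + 3) *
    (f ((4 * k) / 2 ^ (n + 2)) - 2 * f ((4 * k + 1) / 2 ^ (n + 2))
      + 2 * f ((4 * k + 3) / 2 ^ (n + 2)) - f ((4 * k + 4) / 2 ^ (n + 2)))

/-- The estimator `𝓡̂_n(f) = 1 - (1/n) log₂ √(Σ_k (ϑ^f_{n,k})²)`. -/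
noncomputable def Rhat (n : ℕ) (f : ℝ → ℝ) : ℝ :=
  1 - (1 / (n : ℝ)) * Real.logb 2 (Real.sqrt (∑ k ∈ Finset.range (2 ^ n), (vartheta f n k) ^ 2))

/-- Covariance function of fractional Brownian motion with Hurst parameter `H`. -/
noncomputable def fbmCov (H s t : ℝ) : ℝ :=
  (s ^ (2 * H) + t ^ (2 * H) - |s - t| ^ (2 * H)) / 2

/-- `W` is a fractional Brownian motion with Hurst parameter `H` on `[0,1]`:
it has a.s. continuous paths and centered Gaussian finite-dimensional distributions
with covariance `fbmCov H`. -/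
def IsFBM {Ω : Type*} [MeasurableSpace Ω] (P : Measure Ω) (H : ℝ) (W : ℝ → Ω → ℝ) : Prop :=
  (∀ t, Measurable (W t)) ∧
  (∀ᵐ ω ∂P, ContinuousOn (fun t => W t ω) (Set.Icc 0 1)) ∧
  ∀ (n : ℕ) (t c : Fin n → ℝ), (∀ i, t i ∈ Set.Icc (0 : ℝ) 1) →
    Measure.map (fun ω => ∑ i, c i * W (t i) ω) P =
      gaussianReal 0 (Real.toNNReal (∑ i, ∑ j, c i * c j * fbmCov H (t i) (t j)))

lemma integral_sq_gaussianReal (v : NNReal) : ∫ x, x ^ 2 ∂(gaussianReal 0 v) = v := by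
  have h := variance_fun_id_gaussianReal (μ := 0) (v := v)
  rw [variance_eq_integral (by fun_prop)] at h
  simpa using h

lemma integral_pow_four_gaussianReal (v : NNReal) :
    ∫ x, x ^ 4 ∂(gaussianReal 0 v) = 3 * (v : ℝ) ^ 2 := by
  have h := iteratedDeriv_mgf_zero (X := id) (μ := gaussianReal 0 v)
    (by simp [integrableExpSet_id_gaussianReal]) 4
  simp only [mgf_id_gaussianReal, Pi.pow_apply, id] at h
  rw [← h]
  have key : ∀ p p' : ℝ → ℝ, (∀ t, HasDerivAt p (p' t) t) →
      deriv (fun t : ℝ => p t * Real.exp (0 * t + v * t ^ 2 / 2)) =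
        fun t => (p' t + p t * (v * t)) * Real.exp (0 * t + v * t ^ 2 / 2) := by
    intro p p' hp
    funext t
    have h1 : HasDerivAt (fun t : ℝ => Real.exp (0 * t + v * t ^ 2 / 2))
        (Real.exp (0 * t + v * t ^ 2 / 2) * (v * t)) t := by
      apply HasDerivAt.exp
      have := (((hasDerivAt_id t).pow 2).const_mul (v : ℝ)).div_const 2
      have h2 := ((hasDerivAt_id t).const_mul (0 : ℝ)).add this
      refine h2.congr_deriv ?_
      simp
      ring
    rw [((hp t).fun_mul h1).deriv]
    ring
  have e0 : (fun t : ℝ => Real.exp (0 * t + v * t ^ 2 / 2)) =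
      fun t => (fun _ => (1 : ℝ)) t * Real.exp (0 * t + v * t ^ 2 / 2) := by simp
  rw [e0, iteratedDeriv_succ', key _ (fun _ => 0) (fun t => hasDerivAt_const t 1),
    iteratedDeriv_succ', key (fun t => 0 + 1 * (v * t)) (fun _ => (v : ℝ)),
    iteratedDeriv_succ', key (fun t => v + (0 + 1 * (v * t)) * (v * t)) (fun t => 2 * v ^ 2 * t),
    iteratedDeriv_succ', key (fun t => 2 * v ^ 2 * t + (v + (0 + 1 * (v * t)) * (v * t)) * (v * t))
      (fun t => 3 * v ^ 2 + 3 * v ^ 3 * t ^ 2)]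
  · simp
  · intro t
    have e : (fun t : ℝ => 2 * (v : ℝ) ^ 2 * t + (v + (0 + 1 * (v * t)) * (v * t)) * (v * t)) =
        fun t => 3 * (v : ℝ) ^ 2 * t + v ^ 3 * t ^ 3 := by funext t; ring
    rw [e]
    refine (((hasDerivAt_id t).const_mul _).add
      (((hasDerivAt_id t).pow 3).const_mul _)).congr_deriv ?_
    simp; ring
  · intro t
    have e : (fun t : ℝ => (v : ℝ) + (0 + 1 * (v * t)) * (v * t)) =
        fun t => (v : ℝ) + v ^ 2 * t ^ 2 := by funext t; ring
    rw [e]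
    refine ((hasDerivAt_const t _).add (((hasDerivAt_id t).pow 2).const_mul _)).congr_deriv ?_
    simp; ring
  · intro t
    have e : (fun t : ℝ => (0 : ℝ) + 1 * (v * t)) = fun t => (v : ℝ) * t := by funext t; ring
    rw [e]
    simpa using (hasDerivAt_id t).const_mul (v : ℝ)

lemma integral_pow_even_gaussianReal (v : NNReal) (N : ℕ) :
    ∫ x, x ^ (2 * N) ∂(gaussianReal 0 v) = (v : ℝ) ^ N * ∫ x, x ^ (2 * N) ∂(gaussianReal 0 1) := by
  have h := gaussianReal_map_const_mul (μ := 0) (v := 1) (Real.sqrt v)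
  have h2 : NNReal.mk (Real.sqrt v ^ 2) (sq_nonneg _) * 1 = v := by
    ext; simp
  rw [mul_zero, h2] at h
  rw [← h, integral_map (by fun_prop) (by fun_prop), ← integral_const_mul]
  congr 1
  funext x
  rw [mul_pow, pow_mul (Real.sqrt v), Real.sq_sqrt v.coe_nonneg]

section

variable {Ω : Type*} [MeasurableSpace Ω] {P : Measure Ω}

lemma integrable_pow_of_map_gaussian {Z : Ω → ℝ} (hZ : Measurable Z) {v : NNReal}
    (h : Measure.map Z P = gaussianReal 0 v) (k : ℕ) : Integrable (fun ω => Z ω ^ k) P := by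
  have h1 : MemLp (id : ℝ → ℝ) k (gaussianReal 0 v) := memLp_id_gaussianReal' _ (by simp)
  have h2 : Integrable (fun x : ℝ => x ^ k) (gaussianReal 0 v) := by
    rw [← integrable_norm_iff (by fun_prop)]
    simpa using h1.integrable_norm_pow'
  rw [← h] at h2
  exact (integrable_map_measure (measurable_id.pow_const k).aestronglyMeasurable
    hZ.aemeasurable).1 h2

lemma integral_pow_of_map_gaussian {Z : Ω → ℝ} (hZ : Measurable Z) {v : NNReal}
    (h : Measure.map Z P = gaussianReal 0 v) (k : ℕ) :
    ∫ ω, Z ω ^ k ∂P = ∫ x, x ^ k ∂(gaussianReal 0 v) := by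
  rw [← h, integral_map hZ.aemeasurable
    (f := fun x : ℝ => x ^ k) (measurable_id.pow_const k).aestronglyMeasurable]

end

/-- A centered Gaussian random variable on `(Ω, P)`. -/
def IsCenteredGaussian {Ω : Type*} [MeasurableSpace Ω] (P : Measure Ω) (Z : Ω → ℝ) : Prop :=
  Measurable Z ∧ Measure.map Z P = gaussianReal 0 (Real.toNNReal (∫ ω, Z ω ^ 2 ∂P))

section

variable {Ω : Type*} [MeasurableSpace Ω] {P : Measure Ω}

namespace IsCenteredGaussian

lemma integrable_pow {Z : Ω → ℝ} (h : IsCenteredGaussian P Z) (k : ℕ) :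
    Integrable (fun ω => Z ω ^ k) P :=
  integrable_pow_of_map_gaussian h.1 h.2 k

lemma integral_pow_four {Z : Ω → ℝ} (h : IsCenteredGaussian P Z) :
    ∫ ω, Z ω ^ 4 ∂P = 3 * (∫ ω, Z ω ^ 2 ∂P) ^ 2 := by
  rw [integral_pow_of_map_gaussian h.1 h.2 4, integral_pow_four_gaussianReal,
    Real.coe_toNNReal _ (integral_nonneg fun ω => sq_nonneg _)]

lemma integral_pow_even {Z : Ω → ℝ} (h : IsCenteredGaussian P Z) (N : ℕ) :
    ∫ ω, Z ω ^ (2 * N) ∂P =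
      (∫ ω, Z ω ^ 2 ∂P) ^ N * ∫ x, x ^ (2 * N) ∂(gaussianReal 0 1) := by
  rw [integral_pow_of_map_gaussian h.1 h.2, integral_pow_even_gaussianReal,
    Real.coe_toNNReal _ (integral_nonneg fun ω => sq_nonneg _)]

lemma of_map {Z : Ω → ℝ} (hm : Measurable Z) {v : ℝ} (hv : 0 ≤ v)
    (h : Measure.map Z P = gaussianReal 0 (Real.toNNReal v)) :
    IsCenteredGaussian P Z ∧ ∫ ω, Z ω ^ 2 ∂P = v := by
  have h2 : ∫ ω, Z ω ^ 2 ∂P = v := by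
    rw [integral_pow_of_map_gaussian hm h 2, integral_sq_gaussianReal, Real.coe_toNNReal _ hv]
  exact ⟨⟨hm, by rw [h2, h]⟩, h2⟩

lemma integrable_mul {Z Z' : Ω → ℝ} (h : IsCenteredGaussian P Z)
    (h' : IsCenteredGaussian P Z') : Integrable (fun ω => Z ω * Z' ω) P := by
  refine ((h.integrable_pow 2).add (h'.integrable_pow 2)).mono'
    (h.1.mul h'.1).aestronglyMeasurable (ae_of_all _ fun ω => ?_)
  simp only [Pi.add_apply, Real.norm_eq_abs, abs_le]
  constructor <;> nlinarith [sq_nonneg (Z ω + Z' ω), sq_nonneg (Z ω - Z' ω), sq_nonneg (Z ω),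
    sq_nonneg (Z' ω)]

lemma integrable_sq_mul_sq {Z Z' : Ω → ℝ} (h : IsCenteredGaussian P Z)
    (h' : IsCenteredGaussian P Z') : Integrable (fun ω => Z ω ^ 2 * Z' ω ^ 2) P := by
  refine ((h.integrable_pow 4).add (h'.integrable_pow 4)).mono'
    ((h.1.pow_const 2).mul (h'.1.pow_const 2)).aestronglyMeasurable (ae_of_all _ fun ω => ?_)
  simp only [Pi.add_apply, Real.norm_eq_abs, abs_le]
  constructor <;> nlinarith [sq_nonneg (Z ω ^ 2 + Z' ω ^ 2), sq_nonneg (Z ω ^ 2 - Z' ω ^ 2),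
    sq_nonneg (Z ω ^ 2), sq_nonneg (Z' ω ^ 2)]

/-- Isserlis' formula for the mixed fourth moment. -/
lemma integral_sq_mul_sq {Z Z' : Ω → ℝ} (h : IsCenteredGaussian P Z)
    (h' : IsCenteredGaussian P Z') (hp : IsCenteredGaussian P (fun ω => Z ω + Z' ω))
    (hm : IsCenteredGaussian P (fun ω => Z ω - Z' ω)) :
    ∫ ω, Z ω ^ 2 * Z' ω ^ 2 ∂P =
      (∫ ω, Z ω ^ 2 ∂P) * (∫ ω, Z' ω ^ 2 ∂P) + 2 * (∫ ω, Z ω * Z' ω ∂P) ^ 2 := by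
  have i2 := h.integrable_pow 2
  have i2' := h'.integrable_pow 2
  have im := h.integrable_mul h'
  have e2 : ∀ s : ℝ, ∫ ω, (Z ω ^ 2 + Z' ω ^ 2 + s * (Z ω * Z' ω)) ∂P =
      (∫ ω, Z ω ^ 2 ∂P) + (∫ ω, Z' ω ^ 2 ∂P) + s * ∫ ω, Z ω * Z' ω ∂P := by
    intro s
    rw [integral_add (by fun_prop) (by fun_prop), integral_add i2 i2', integral_const_mul]
  have ep : ∫ ω, (Z ω + Z' ω) ^ 2 ∂P = (∫ ω, Z ω ^ 2 ∂P) + (∫ ω, Z' ω ^ 2 ∂P) +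
      2 * ∫ ω, Z ω * Z' ω ∂P := by
    rw [← e2]; congr 1; funext ω; ring
  have em : ∫ ω, (Z ω - Z' ω) ^ 2 ∂P = (∫ ω, Z ω ^ 2 ∂P) + (∫ ω, Z' ω ^ 2 ∂P) +
      (-2) * ∫ ω, Z ω * Z' ω ∂P := by
    rw [← e2]; congr 1; funext ω; ring
  have e4 : (∫ ω, (Z ω + Z' ω) ^ 4 ∂P) + ∫ ω, (Z ω - Z' ω) ^ 4 ∂P =
      2 * (∫ ω, Z ω ^ 4 ∂P) + 2 * (∫ ω, Z' ω ^ 4 ∂P) + 12 * ∫ ω, Z ω ^ 2 * Z' ω ^ 2 ∂P := by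
    have i4 := h.integrable_pow 4
    have i4' := h'.integrable_pow 4
    have i22 := h.integrable_sq_mul_sq h'
    rw [← integral_add (hp.integrable_pow 4) (hm.integrable_pow 4), ← integral_const_mul,
      ← integral_const_mul, ← integral_const_mul, ← integral_add (by fun_prop) (by fun_prop),
      ← integral_add (by fun_prop) (by fun_prop)]
    congr 1; funext ω; ring
  rw [hp.integral_pow_four, hm.integral_pow_four, h.integral_pow_four, h'.integral_pow_four, ep,
    em] at e4
  linarith

end IsCenteredGaussian

namespace IsFBM

variable {H : ℝ} {W : ℝ → Ω → ℝ}

lemma map_sum (hW : IsFBM P H W) {ι : Type*} [Fintype ι] (t c : ι → ℝ)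
    (ht : ∀ i, t i ∈ Set.Icc (0 : ℝ) 1) :
    Measure.map (fun ω => ∑ i, c i * W (t i) ω) P =
      gaussianReal 0 (Real.toNNReal (∑ i, ∑ j, c i * c j * fbmCov H (t i) (t j))) := by
  have h := hW.2.2 (Fintype.card ι) (t ∘ (Fintype.equivFin ι).symm)
    (c ∘ (Fintype.equivFin ι).symm) (fun i => ht _)
  simp only [Function.comp] at h
  have e1 : ∀ ω, ∑ i, c ((Fintype.equivFin ι).symm i) * W (t ((Fintype.equivFin ι).symm i)) ω =
      ∑ i, c i * W (t i) ω := fun ω =>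
    Equiv.sum_comp (Fintype.equivFin ι).symm (fun i => c i * W (t i) ω)
  simp only [e1] at h
  rw [h]
  congr 2
  rw [← Equiv.sum_comp (Fintype.equivFin ι).symm (fun i => ∑ j, c i * c j * fbmCov H (t i) (t j))]
  refine Finset.sum_congr rfl fun i _ => ?_
  rw [← Equiv.sum_comp (Fintype.equivFin ι).symm]

lemma measurable_sum (hW : IsFBM P H W) {ι : Type*} [Fintype ι] (t c : ι → ℝ) :
    Measurable (fun ω => ∑ i, c i * W (t i) ω) :=
  Finset.measurable_sum _ fun i _ => (hW.1 (t i)).const_mul _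

lemma integral_sq (hW : IsFBM P H W) (hH : 0 < H) {t : ℝ} (ht : t ∈ Set.Icc (0 : ℝ) 1) :
    IsCenteredGaussian P (W t) ∧ ∫ ω, W t ω ^ 2 ∂P = t ^ (2 * H) := by
  have h := hW.map_sum (ι := Unit) (fun _ => t) (fun _ => 1) (fun _ => ht)
  simp only [Finset.univ_unique, Finset.sum_const, Finset.card_singleton, one_smul, one_mul] at h
  refine IsCenteredGaussian.of_map (hW.1 t) (Real.rpow_nonneg ht.1 _) ?_
  rw [h]
  congr 2
  simp [fbmCov, Real.zero_rpow (by positivity : 2 * H ≠ 0)]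

lemma integral_sub_sq (hW : IsFBM P H W) (hH : 0 < H) {s t : ℝ} (hs : s ∈ Set.Icc (0 : ℝ) 1)
    (ht : t ∈ Set.Icc (0 : ℝ) 1) :
    IsCenteredGaussian P (fun ω => W s ω - W t ω) ∧
      ∫ ω, (W s ω - W t ω) ^ 2 ∂P = |s - t| ^ (2 * H) := by
  have h := hW.map_sum (ι := Bool) (fun b => if b then s else t) (fun b => if b then 1 else -1)
    (fun b => by cases b <;> simp [hs.1, hs.2, ht.1, ht.2])
  refine IsCenteredGaussian.of_map ((hW.1 s).sub (hW.1 t)) (by positivity) ?_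
  have e : (W s - W t) = fun ω => ∑ b : Bool, (if b then (1 : ℝ) else -1) *
      W (if b then s else t) ω := by
    funext ω; simp; ring
  rw [e, h]
  congr 2
  simp [fbmCov, Real.zero_rpow (by positivity : 2 * H ≠ 0), abs_sub_comm t s]
  ring

lemma integral_mul (hW : IsFBM P H W) (hH : 0 < H) {s t : ℝ} (hs : s ∈ Set.Icc (0 : ℝ) 1)
    (ht : t ∈ Set.Icc (0 : ℝ) 1) : ∫ ω, W s ω * W t ω ∂P = fbmCov H s t := by
  have hs' := hW.integral_sq hH hs
  have ht' := hW.integral_sq hH ht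
  have hst := hW.integral_sub_sq hH hs ht
  have e : ∀ ω, W s ω * W t ω = (W s ω ^ 2 + W t ω ^ 2 - (W s ω - W t ω) ^ 2) / 2 := by
    intro ω; ring
  simp only [e]
  have is := hs'.1.integrable_pow 2
  have it := ht'.1.integrable_pow 2
  rw [integral_div, integral_sub (by fun_prop) (hst.1.integrable_pow 2),
    integral_add (hs'.1.integrable_pow 2) (ht'.1.integrable_pow 2),
    hs'.2, ht'.2, hst.2]
  rfl

lemma integral_sum_mul_sum (hW : IsFBM P H W) (hH : 0 < H) {ι κ : Type*} [Fintype ι] [Fintype κ]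
    (t c : ι → ℝ) (t' c' : κ → ℝ) (ht : ∀ i, t i ∈ Set.Icc (0 : ℝ) 1)
    (ht' : ∀ i, t' i ∈ Set.Icc (0 : ℝ) 1) :
    ∫ ω, (∑ i, c i * W (t i) ω) * (∑ j, c' j * W (t' j) ω) ∂P =
      ∑ i, ∑ j, c i * c' j * fbmCov H (t i) (t' j) := by
  have im : ∀ i j, Integrable (fun ω => c i * c' j * (W (t i) ω * W (t' j) ω)) P := fun i j =>
    ((hW.integral_sq hH (ht i)).1.integrable_mul (hW.integral_sq hH (ht' j)).1).const_mul _
  have e : ∀ ω, (∑ i, c i * W (t i) ω) * (∑ j, c' j * W (t' j) ω) =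
      ∑ i, ∑ j, c i * c' j * (W (t i) ω * W (t' j) ω) := by
    intro ω
    rw [Finset.sum_mul_sum]
    exact Finset.sum_congr rfl fun i _ => Finset.sum_congr rfl fun j _ => by ring
  simp only [e]
  rw [integral_finsetSum _ fun i _ => integrable_finsetSum _ fun j _ => im i j]
  refine Finset.sum_congr rfl fun i _ => ?_
  rw [integral_finsetSum _ fun j _ => im i j]
  refine Finset.sum_congr rfl fun j _ => ?_
  rw [integral_const_mul, hW.integral_mul hH (ht i) (ht' j)]

lemma isCenteredGaussian_sum (hW : IsFBM P H W) (hH : 0 < H) {ι : Type*} [Fintype ι]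
    (t c : ι → ℝ) (ht : ∀ i, t i ∈ Set.Icc (0 : ℝ) 1) :
    IsCenteredGaussian P (fun ω => ∑ i, c i * W (t i) ω) := by
  refine ⟨hW.measurable_sum t c, ?_⟩
  rw [hW.map_sum t c ht, ← hW.integral_sum_mul_sum hH t c t c ht ht]
  simp only [sq]

/-- Isserlis' formula for two linear functionals of a fractional Brownian motion. -/
lemma integral_sum_sq_mul_sum_sq (hW : IsFBM P H W) (hH : 0 < H) {ι κ : Type*} [Fintype ι]
    [Fintype κ] (t c : ι → ℝ) (t' c' : κ → ℝ) (ht : ∀ i, t i ∈ Set.Icc (0 : ℝ) 1)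
    (ht' : ∀ i, t' i ∈ Set.Icc (0 : ℝ) 1) :
    ∫ ω, (∑ i, c i * W (t i) ω) ^ 2 * (∑ j, c' j * W (t' j) ω) ^ 2 ∂P =
      (∫ ω, (∑ i, c i * W (t i) ω) ^ 2 ∂P) * (∫ ω, (∑ j, c' j * W (t' j) ω) ^ 2 ∂P) +
        2 * (∑ i, ∑ j, c i * c' j * fbmCov H (t i) (t' j)) ^ 2 := by
  have hs : ∀ i, Sum.elim t t' i ∈ Set.Icc (0 : ℝ) 1 := by
    rintro (i | i)
    · exact ht i
    · exact ht' i
  have hp := hW.isCenteredGaussian_sum hH (Sum.elim t t') (Sum.elim c c') hs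
  have hm := hW.isCenteredGaussian_sum hH (Sum.elim t t') (Sum.elim c (fun j => -c' j)) hs
  simp only [Fintype.sum_sum_type, Sum.elim_inl, Sum.elim_inr, neg_mul, Finset.sum_neg_distrib,
    ← sub_eq_add_neg] at hp hm
  rw [(hW.isCenteredGaussian_sum hH t c ht).integral_sq_mul_sq
    (hW.isCenteredGaussian_sum hH t' c' ht') hp hm, hW.integral_sum_mul_sum hH t c t' c' ht ht']

end IsFBM

end

/-- The sign pattern `-1, 1, 1, -1` on the four quarters of `{0, …, 4 q - 1}`. -/
def quarterSign (q i : ℕ) : ℝ := if i < q then -1 else if i < 3 * q then 1 else -1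

lemma abs_quarterSign (q i : ℕ) : |quarterSign q i| = 1 := by
  unfold quarterSign; split_ifs <;> simp

lemma sum_quarterSign_mul_sub (q : ℕ) (G : ℕ → ℝ) :
    ∑ i ∈ Finset.range (4 * q), quarterSign q i * (G (i + 1) - G i) =
      G 0 - 2 * G q + 2 * G (3 * q) - G (4 * q) := by
  have tele : ∀ a b : ℕ, a ≤ b → ∀ s : ℝ, (∀ i, a ≤ i → i < b → quarterSign q i = s) →
      ∑ i ∈ Finset.Ico a b, quarterSign q i * (G (i + 1) - G i) = s * (G b - G a) := by
    intro a b hab s hs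
    rw [← Finset.sum_Ico_sub G hab, Finset.mul_sum]
    refine Finset.sum_congr rfl fun i hi => ?_
    rw [Finset.mem_Ico] at hi
    rw [hs i hi.1 hi.2]
  rw [Finset.range_eq_Ico, ← Finset.sum_Ico_consecutive _ (Nat.zero_le q) (by omega : q ≤ 4 * q),
    ← Finset.sum_Ico_consecutive _ (by omega : q ≤ 3 * q) (by omega : 3 * q ≤ 4 * q),
    tele 0 q (by omega) (-1), tele q (3 * q) (by omega) 1, tele (3 * q) (4 * q) (by omega) (-1)]
  · ring
  · intro i h1 h2
    simp [quarterSign, show ¬ i < q by omega, show ¬ i < 3 * q by omega]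
  · intro i h1 h2
    simp [quarterSign, show ¬ i < q by omega, h2]
  · intro i h1 h2
    simp [quarterSign, h2]

lemma sum_quarterSign (q : ℕ) : ∑ i ∈ Finset.range (4 * q), quarterSign q i = 0 := by
  have h := sum_quarterSign_mul_sub q (fun i => (i : ℝ))
  push_cast at h
  simp only [add_sub_cancel_left, mul_one] at h
  rw [h]
  ring

lemma abs_quarter_sub_sum_le (q : ℕ) (G a : ℕ → ℝ) (e : ℝ)
    (h : ∀ i < 4 * q, |G (i + 1) - G i - a i| ≤ e) :
    |G 0 - 2 * G q + 2 * G (3 * q) - G (4 * q) -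
      ∑ i ∈ Finset.range (4 * q), quarterSign q i * a i| ≤ (4 * q : ℕ) * e := by
  rw [← sum_quarterSign_mul_sub, ← Finset.sum_sub_distrib]
  refine (Finset.abs_sum_le_sum_abs _ _).trans ?_
  have : ∀ i ∈ Finset.range (4 * q),
      |quarterSign q i * (G (i + 1) - G i) - quarterSign q i * a i| ≤ e := by
    intro i hi
    rw [← mul_sub, abs_mul, abs_quarterSign, one_mul]
    exact h i (Finset.mem_range.1 hi)
  refine (Finset.sum_le_sum this).trans ?_
  simp

/-- The doubly signed average of `φ (x + s - t)` over the grid of mesh `1 / (4 q)`. -/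
noncomputable def quarterForm (φ : ℝ → ℝ) (q : ℕ) (x : ℝ) : ℝ :=
  (1 / (4 * q : ℕ) : ℝ) ^ 2 * ∑ i ∈ Finset.range (4 * q), ∑ j ∈ Finset.range (4 * q),
    quarterSign q i * quarterSign q j * φ (x + (i / (4 * q : ℕ) - j / (4 * q : ℕ)))

lemma quarterForm_eq_mixed (φ : ℝ → ℝ) (q : ℕ) (x : ℝ) :
    quarterForm φ q x = (1 / (4 * q : ℕ) : ℝ) ^ 2 *
      ∑ i ∈ Finset.range (4 * q), ∑ j ∈ Finset.range (4 * q),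
      quarterSign q i * quarterSign q j * (φ (x + (i / (4 * q : ℕ) - j / (4 * q : ℕ))) -
        φ (x + i / (4 * q : ℕ)) - φ (x - j / (4 * q : ℕ)) + φ x) := by
  unfold quarterForm
  congr 1
  have e : ∀ i j : ℕ, quarterSign q i * quarterSign q j *
      (φ (x + (i / (4 * q : ℕ) - j / (4 * q : ℕ))) -
        φ (x + i / (4 * q : ℕ)) - φ (x - j / (4 * q : ℕ)) + φ x) =
      quarterSign q i * quarterSign q j * φ (x + (i / (4 * q : ℕ) - j / (4 * q : ℕ))) -
      quarterSign q i * φ (x + i / (4 * q : ℕ)) * quarterSign q j -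
      quarterSign q i * (quarterSign q j * (φ (x - j / (4 * q : ℕ)) - φ x)) := by
    intro i j; ring
  simp only [e, Finset.sum_sub_distrib, ← Finset.mul_sum, ← Finset.sum_mul, sum_quarterSign,
    mul_zero, zero_mul, sub_zero]

lemma abs_signed_average_le (q : ℕ) (F : ℕ → ℕ → ℝ) (B : ℝ) (hB : 0 ≤ B)
    (h : ∀ i < 4 * q, ∀ j < 4 * q, |F i j| ≤ B) :
    |(1 / (4 * q : ℕ) : ℝ) ^ 2 * ∑ i ∈ Finset.range (4 * q), ∑ j ∈ Finset.range (4 * q),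
      quarterSign q i * quarterSign q j * F i j| ≤ B := by
  have h1 : |∑ i ∈ Finset.range (4 * q), ∑ j ∈ Finset.range (4 * q),
      quarterSign q i * quarterSign q j * F i j| ≤ (4 * q : ℕ) * ((4 * q : ℕ) * B) := by
    refine (Finset.abs_sum_le_sum_abs _ _).trans ?_
    refine (Finset.sum_le_card_nsmul _ _ ((4 * q : ℕ) * B) fun i hi => ?_).trans (by simp)
    refine (Finset.abs_sum_le_sum_abs _ _).trans ?_
    refine (Finset.sum_le_card_nsmul _ _ B fun j hj => ?_).trans (by simp)
    rw [abs_mul, abs_mul, abs_quarterSign, abs_quarterSign, one_mul, one_mul]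
    exact h i (Finset.mem_range.1 hi) j (Finset.mem_range.1 hj)
  rw [abs_mul, abs_of_nonneg (by positivity)]
  rcases Nat.eq_zero_or_pos q with rfl | hq
  · simpa using hB
  · refine (mul_le_mul_of_nonneg_left h1 (by positivity)).trans ?_
    have : ((4 * q : ℕ) : ℝ) ≠ 0 := by positivity
    field_simp
    rfl

lemma quarterForm_abs_le {p : ℝ} (hp : 0 < p) (q : ℕ) :
    |quarterForm (fun x => |x| ^ p) q 0| ≤ 1 := by
  refine abs_signed_average_le q _ 1 zero_le_one fun i hi j hj => ?_
  have hq : (0 : ℝ) < (4 * q : ℕ) := by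
    have : 0 < 4 * q := by omega
    exact_mod_cast this
  rw [abs_of_nonneg (by positivity)]
  refine Real.rpow_le_one (abs_nonneg _) ?_ hp.le
  have hi' : (i : ℝ) / (4 * q : ℕ) ≤ 1 := (div_le_one hq).2 (by exact_mod_cast hi.le)
  have hj' : (j : ℝ) / (4 * q : ℕ) ≤ 1 := (div_le_one hq).2 (by exact_mod_cast hj.le)
  have hi0 : 0 ≤ (i : ℝ) / (4 * q : ℕ) := by positivity
  have hj0 : 0 ≤ (j : ℝ) / (4 * q : ℕ) := by positivity
  rw [abs_le]
  constructor <;> linarith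

lemma quarterForm_neg (p : ℝ) (q : ℕ) (x : ℝ) :
    quarterForm (fun x => |x| ^ p) q (-x) = quarterForm (fun x => |x| ^ p) q x := by
  unfold quarterForm
  congr 1
  rw [Finset.sum_comm]
  refine Finset.sum_congr rfl fun i _ => Finset.sum_congr rfl fun j _ => ?_
  have e : -x + ((j : ℝ) / (4 * q : ℕ) - i / (4 * q : ℕ)) =
      -(x + (i / (4 * q : ℕ) - j / (4 * q : ℕ))) := by ring
  simp only [e, abs_neg]
  ring

/-- For a concave power, increments over a fixed step are antitone in the base point. -/
lemma rpow_increment_anti {p : ℝ} (hp0 : 0 ≤ p) (hp1 : p ≤ 1) {x y s : ℝ} (hx : 0 ≤ x)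
    (hxy : x ≤ y) (hs : 0 ≤ s) : (y + s) ^ p - y ^ p ≤ (x + s) ^ p - x ^ p := by
  have hc := Real.concaveOn_rpow hp0 hp1
  rcases (add_nonneg (sub_nonneg.2 hxy) hs).eq_or_lt with h0 | hpos
  · have h1 : y = x := by linarith
    rw [h1]
  · have hd : y - x + s ≠ 0 := hpos.ne'
    have hw : s / (y - x + s) + (y - x) / (y - x + s) = 1 := by field_simp; ring
    have h1 := hc.2 hx (by simp only [Set.mem_Ici]; linarith : y + s ∈ Set.Ici (0 : ℝ))
      (div_nonneg hs hpos.le) (div_nonneg (sub_nonneg.2 hxy) hpos.le) hw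
    have h2 := hc.2 hx (by simp only [Set.mem_Ici]; linarith : y + s ∈ Set.Ici (0 : ℝ))
      (div_nonneg (sub_nonneg.2 hxy) hpos.le) (div_nonneg hs hpos.le) ((add_comm _ _).trans hw)
    have e1 : (s / (y - x + s)) • x + ((y - x) / (y - x + s)) • (y + s) = y := by
      simp only [smul_eq_mul]; field_simp; ring
    have e2 : ((y - x) / (y - x + s)) • x + (s / (y - x + s)) • (y + s) = x + s := by
      simp only [smul_eq_mul]; field_simp; ring
    rw [e1] at h1
    rw [e2] at h2
    simp only [smul_eq_mul] at h1 h2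
    have e3 : (y - x) / (y - x + s) = 1 - s / (y - x + s) := by linarith
    rw [e3] at h1 h2
    linarith

/-- The negative second difference of `x ↦ x ^ p` at `d + 1`. -/
noncomputable def secondDiff (p : ℝ) (d : ℕ) : ℝ :=
  2 * ((d : ℝ) + 1) ^ p - (d : ℝ) ^ p - ((d : ℝ) + 2) ^ p

lemma secondDiff_nonneg {p : ℝ} (hp0 : 0 ≤ p) (hp1 : p ≤ 1) (d : ℕ) : 0 ≤ secondDiff p d := by
  have h := rpow_increment_anti hp0 hp1 (x := d) (y := d + 1) (s := 1) (by positivity)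
    (by linarith) zero_le_one
  unfold secondDiff
  have e : (d : ℝ) + 1 + 1 = d + 2 := by ring
  rw [e] at h
  linarith

lemma sum_secondDiff_le {p : ℝ} (hp0 : 0 < p) (N : ℕ) :
    ∑ d ∈ Finset.range N, secondDiff p d ≤ 1 := by
  have h : ∑ d ∈ Finset.range N, secondDiff p d = 1 - (((N : ℝ) + 1) ^ p - (N : ℝ) ^ p) := by
    induction N with
    | zero => simp [Real.zero_rpow hp0.ne']
    | succ N ih =>
      rw [Finset.sum_range_succ, ih, secondDiff]
      push_cast
      have e : (N : ℝ) + 1 + 1 = N + 2 := by ring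
      rw [e]; ring
  rw [h]
  have : (N : ℝ) ^ p ≤ ((N : ℝ) + 1) ^ p :=
    Real.rpow_le_rpow (by positivity) (by linarith) hp0.le
  linarith

lemma quarterForm_succ_abs_le {p : ℝ} (hp0 : 0 < p) (hp1 : p ≤ 1) (q d : ℕ) :
    |quarterForm (fun x => |x| ^ p) q ((d : ℝ) + 1)| ≤ secondDiff p d := by
  rw [quarterForm_eq_mixed]
  refine abs_signed_average_le q _ _ (secondDiff_nonneg hp0.le hp1 d) fun i hi j hj => ?_
  have hq : (0 : ℝ) < (4 * q : ℕ) := by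
    have : 0 < 4 * q := by omega
    exact_mod_cast this
  have hi' : (i : ℝ) / (4 * q : ℕ) ≤ 1 := (div_le_one hq).2 (by exact_mod_cast hi.le)
  have hj' : (j : ℝ) / (4 * q : ℕ) ≤ 1 := (div_le_one hq).2 (by exact_mod_cast hj.le)
  have hi0 : 0 ≤ (i : ℝ) / (4 * q : ℕ) := by positivity
  have hj0 : 0 ≤ (j : ℝ) / (4 * q : ℕ) := by positivity
  generalize (i : ℝ) / (4 * q : ℕ) = s at *
  generalize (j : ℝ) / (4 * q : ℕ) = t at *
  have hd : (0 : ℝ) ≤ d := by positivity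
  rw [abs_of_nonneg (by linarith : 0 ≤ (d : ℝ) + 1 + (s - t)),
    abs_of_nonneg (by linarith : 0 ≤ (d : ℝ) + 1 + s),
    abs_of_nonneg (by linarith : 0 ≤ (d : ℝ) + 1 - t),
    abs_of_nonneg (by linarith : 0 ≤ (d : ℝ) + 1)]
  have h1 := rpow_increment_anti hp0.le hp1 (x := (d : ℝ) + 1 - t) (y := d + 1) (s := s)
    (by linarith) (by linarith) hi0
  have h2 := rpow_increment_anti hp0.le hp1 (x := (d : ℝ)) (y := d + 1 - t) (s := s)
    (by linarith) (by linarith) hi0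
  have h3 := rpow_increment_anti hp0.le hp1 (x := (d : ℝ) + s) (y := d + 1) (s := 1)
    (by linarith) (by linarith) zero_le_one
  have h4 := rpow_increment_anti hp0.le hp1 (x := (d : ℝ) + s) (y := (d : ℝ) + 1) (s := 1)
    (by linarith) (by linarith) zero_le_one
  have e1 : (d : ℝ) + 1 - t + s = d + 1 + (s - t) := by ring
  have e2 : (d : ℝ) + 1 + 1 = d + 2 := by ring
  have e3 : (d : ℝ) + s + 1 = d + 1 + s := by ring
  rw [e1] at h1 h2
  rw [e2, e3] at h3
  unfold secondDiff
  rw [abs_le]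
  constructor <;> linarith

lemma sum_dist_le {b : ℕ → ℝ} (B : ℝ) (hB : ∀ N, ∑ d ∈ Finset.range N, b d ≤ B)
    (F : ℕ → ℝ) {k N : ℕ} (hk : k < N) (h1 : ∀ d, F (k + d) ≤ b d)
    (h2 : ∀ d, d + 1 ≤ k → F (k - 1 - d) ≤ b (d + 1)) (hb0 : 0 ≤ b 0) :
    ∑ l ∈ Finset.range N, F l ≤ 2 * B := by
  rw [Finset.range_eq_Ico, ← Finset.sum_Ico_consecutive F (Nat.zero_le k) hk.le,
    ← Finset.range_eq_Ico, ← Finset.sum_range_reflect, Finset.sum_Ico_eq_sum_range]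
  have e1 : ∑ d ∈ Finset.range k, F (k - 1 - d) ≤ B := by
    refine le_trans ?_ (hB (k + 1))
    rw [Finset.sum_range_succ']
    refine le_trans (Finset.sum_le_sum fun d hd => h2 d ?_) (le_add_of_nonneg_right hb0)
    have := Finset.mem_range.1 hd
    omega
  have e2 : ∑ d ∈ Finset.range (N - k), F (k + d) ≤ B :=
    (Finset.sum_le_sum fun d _ => h1 d).trans (hB _)
  linarith

/-- Summability of the correlations, uniformly in the mesh. -/
lemma sum_quarterForm_sq_le {p : ℝ} (hp0 : 0 < p) (hp1 : p ≤ 1) (q : ℕ) {k N : ℕ} (hk : k < N) :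
    ∑ l ∈ Finset.range N, quarterForm (fun x => |x| ^ p) q ((k : ℝ) - l) ^ 2 ≤ 4 := by
  set b : ℕ → ℝ := fun d => Nat.casesOn d 1 (secondDiff p) with hb
  have hsd1 : ∀ d, secondDiff p d ≤ 1 := fun d =>
    (Finset.single_le_sum (f := secondDiff p) (fun i _ => secondDiff_nonneg hp0.le hp1 i)
      (Finset.self_mem_range_succ d)).trans (sum_secondDiff_le hp0 (d + 1))
  have key : ∀ d : ℕ, quarterForm (fun x => |x| ^ p) q d ^ 2 ≤ b d := by
    intro d
    rcases d with _ | d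
    · have := quarterForm_abs_le hp0 q
      change _ ≤ (1 : ℝ)
      rw [Nat.cast_zero]
      rw [← sq_abs]
      nlinarith [abs_nonneg (quarterForm (fun x => |x| ^ p) q 0)]
    · have := quarterForm_succ_abs_le hp0 hp1 q d
      simp only [hb, Nat.cast_succ]
      rw [← sq_abs]
      nlinarith [abs_nonneg (quarterForm (fun x => |x| ^ p) q ((d : ℝ) + 1)), hsd1 d]
  refine (sum_dist_le (b := b) 2 (fun N => ?_) _ hk (fun d => ?_) (fun d hd => ?_) ?_).trans
    (by norm_num)
  · rcases N with _ | N
    · simp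
    · rw [Finset.sum_range_succ']
      have := sum_secondDiff_le hp0 N
      change (∑ d ∈ Finset.range N, secondDiff p d) + 1 ≤ 2
      linarith
  · have e : (k : ℝ) - ((k + d : ℕ) : ℝ) = -(d : ℝ) := by push_cast; ring
    rw [e, quarterForm_neg]
    exact key d
  · have e : (k : ℝ) - ((k - 1 - d : ℕ) : ℝ) = ((d + 1 : ℕ) : ℝ) := by
      rw [Nat.cast_sub (by omega), Nat.cast_sub (by omega)]; push_cast; ring
    rw [e]
    exact key (d + 1)
  · simp [hb]

lemma abs_rpow_sub_le {p : ℝ} (hp0 : 0 < p) (hp1 : p ≤ 1) (x y : ℝ) :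
    |(|x| ^ p - |y| ^ p)| ≤ |x - y| ^ p := by
  have key : ∀ x y : ℝ, |x| ^ p ≤ |y| ^ p + |x - y| ^ p := by
    intro x y
    refine le_trans ?_ (Real.rpow_add_le_add_rpow (abs_nonneg y) (abs_nonneg (x - y)) hp0.le hp1)
    refine Real.rpow_le_rpow (abs_nonneg _) ?_ hp0.le
    have := abs_add_le y (x - y)
    simpa using this
  have h1 := key x y
  have h2 := key y x
  rw [abs_sub_comm y x] at h2
  rw [abs_le]
  constructor <;> linarith

lemma hasDerivAt_mul_abs_rpow {p : ℝ} (hp : 0 < p) (x : ℝ) :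
    HasDerivAt (fun x : ℝ => x * |x| ^ p / (p + 1)) (|x| ^ p) x := by
  rcases eq_or_ne x 0 with rfl | hx
  · rw [hasDerivAt_iff_tendsto_slope]
    have hc : Tendsto (fun y : ℝ => |y| ^ p / (p + 1)) (nhdsWithin 0 {0}ᶜ)
        (nhds (|(0 : ℝ)| ^ p / (p + 1))) := by
      refine Tendsto.mono_left ?_ nhdsWithin_le_nhds
      have : Continuous fun y : ℝ => |y| ^ p / (p + 1) :=
        (continuous_abs.rpow_const fun _ => Or.inr hp.le).div_const _
      exact this.tendsto 0
    simp only [abs_zero, Real.zero_rpow hp.ne', zero_div] at hc ⊢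
    refine hc.congr' ?_
    filter_upwards [self_mem_nhdsWithin] with y hy
    have : y ≠ 0 := hy
    simp [slope_def_field]
    field_simp
  · have ha : HasDerivAt (fun x : ℝ => |x|) (SignType.sign x) x := hasDerivAt_abs hx
    have h1 := ha.rpow_const (p := p) (Or.inl (abs_ne_zero.2 hx))
    have h2 := ((hasDerivAt_id x).mul h1).div_const (p + 1)
    refine h2.congr_deriv ?_
    have hs : x * (SignType.sign x : ℝ) = |x| := by
      simp
    have hpow : |x| * |x| ^ (p - 1) = |x| ^ p := by
      rw [mul_comm, ← Real.rpow_add_one (abs_ne_zero.2 hx)]; simp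
    have : (1 * |x| ^ p + x * ((SignType.sign x : ℝ) * p * |x| ^ (p - 1))) / (p + 1) = |x| ^ p := by
      have e : x * ((SignType.sign x : ℝ) * p * |x| ^ (p - 1)) = p * |x| ^ p := by
        rw [← hpow, ← hs]; ring
      rw [e]; field_simp; ring
    simpa using this

lemma hasDerivAt_abs_rpow_add_two {p : ℝ} (hp : 0 < p) (x : ℝ) :
    HasDerivAt (fun x : ℝ => |x| ^ (p + 2) / ((p + 1) * (p + 2))) (x * |x| ^ p / (p + 1)) x := by
  have h := (hasDerivAt_abs_rpow x (p := p + 2) (by linarith)).div_const ((p + 1) * (p + 2))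
  refine h.congr_deriv ?_
  rw [add_sub_cancel_right]
  field_simp

lemma abs_second_difference_sub_le {p : ℝ} (hp0 : 0 < p) (hp1 : p ≤ 1) (x : ℝ) {h : ℝ}
    (hh : 0 < h) :
    |(|x + h| ^ (p + 2) / ((p + 1) * (p + 2)) - 2 * (|x| ^ (p + 2) / ((p + 1) * (p + 2))) +
      |x - h| ^ (p + 2) / ((p + 1) * (p + 2))) - h ^ 2 * |x| ^ p| ≤ h ^ 2 * h ^ p := by
  set F : ℝ → ℝ := fun x => |x| ^ (p + 2) / ((p + 1) * (p + 2)) with hF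
  set f : ℝ → ℝ := fun x => x * |x| ^ p / (p + 1) with hf
  have hd : ∀ z, HasDerivAt (fun z => F (z + h) - F z) (f (z + h) - f z) z := fun z =>
    ((hasDerivAt_abs_rpow_add_two hp0 (z + h)).comp_add_const z h).sub
      (hasDerivAt_abs_rpow_add_two hp0 z)
  obtain ⟨c, hc, hce⟩ := exists_hasDerivAt_eq_slope (fun z => F (z + h) - F z)
    (fun z => f (z + h) - f z) (by linarith : x - h < x)
    (fun z _ => (hd z).continuousAt.continuousWithinAt) (fun z _ => hd z)
  obtain ⟨d, hdm, hde⟩ := exists_hasDerivAt_eq_slope f (fun z => |z| ^ p)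
    (by linarith : c < c + h)
    (fun z _ => (hasDerivAt_mul_abs_rpow hp0 z).continuousAt.continuousWithinAt)
    (fun z _ => hasDerivAt_mul_abs_rpow hp0 z)
  have e1 : F (x + h) - 2 * F x + F (x - h) = h ^ 2 * |d| ^ p := by
    rw [hde, add_sub_cancel_left, hce]
    rw [sub_sub_cancel, sub_add_cancel]
    field_simp
    ring
  change |F (x + h) - 2 * F x + F (x - h) - _| ≤ _
  rw [e1, ← mul_sub, abs_mul, abs_of_nonneg (sq_nonneg h)]
  refine mul_le_mul_of_nonneg_left ((abs_rpow_sub_le hp0 hp1 d x).trans ?_) (sq_nonneg h)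
  refine Real.rpow_le_rpow (abs_nonneg _) ?_ hp0.le
  rw [abs_le]
  constructor <;> linarith [hc.1, hc.2, hdm.1, hdm.2]

lemma rpow_combination_pos {p : ℝ} (hp0 : 0 < p) (hp1 : p ≤ 1) :
    4 * (1 / 4 : ℝ) ^ (p + 2) + 4 * (2 / 4) ^ (p + 2) + 1 ^ (p + 2) <
      4 * (3 / 4 : ℝ) ^ (p + 2) := by
  have key : ∀ r : ℝ, 0 < r → r ≠ 1 → r ^ (p + 2) < r ^ 2 * (1 + p / 2 * (r ^ 2 - 1)) := by
    intro r hr hr1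
    have h1 := rpow_one_add_lt_one_add_mul_self (s := r ^ 2 - 1) (p := p / 2)
      (by nlinarith) (fun h => hr1 (by nlinarith)) (by linarith) (by linarith)
    rw [add_sub_cancel, ← Real.rpow_natCast, ← Real.rpow_mul hr.le] at h1
    rw [Real.rpow_add hr, mul_comm (r ^ p)]
    have e : ((2 : ℕ) : ℝ) * (p / 2) = p := by push_cast; ring
    rw [e] at h1
    rw [Real.rpow_two]
    have h2 := mul_lt_mul_of_pos_left h1 (by positivity : 0 < r ^ 2)
    rwa [Real.rpow_natCast] at h2
  have h3 : (0 : ℝ) < (3 / 4) ^ (p + 2) := by positivity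
  have sc : ∀ r : ℝ, 0 < r → (r * (3 / 4)) ^ (p + 2) = r ^ (p + 2) * (3 / 4) ^ (p + 2) :=
    fun r hr => Real.mul_rpow hr.le (by norm_num)
  have e1 : (1 / 4 : ℝ) = (1 / 3) * (3 / 4) := by norm_num
  have e2 : (2 / 4 : ℝ) = (2 / 3) * (3 / 4) := by norm_num
  have e4 : (1 : ℝ) ^ (p + 2) = ((4 / 3) * (3 / 4)) ^ (p + 2) := by norm_num
  rw [e4, e2, sc _ (by norm_num), sc _ (by norm_num)]
  have e1' : (1 / 4 : ℝ) ^ (p + 2) = (1 / 3) ^ (p + 2) * (3 / 4) ^ (p + 2) := by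
    rw [e1, sc _ (by norm_num)]
  rw [e1']
  have k1 := key (1 / 3) (by norm_num) (by norm_num)
  have k2 := key (2 / 3) (by norm_num) (by norm_num)
  have k4 := key (4 / 3) (by norm_num) (by norm_num)
  nlinarith

/-- The variance of the quarter functional has a negative-definite limit, with a rate. -/
lemma exists_quarterForm_limit {p : ℝ} (hp0 : 0 < p) (hp1 : p ≤ 1) :
    ∃ τ : ℝ, 0 < τ ∧ ∀ q : ℕ, 0 < q →
      |quarterForm (fun x => |x| ^ p) q 0 + τ| ≤ (1 / (4 * q : ℕ) : ℝ) ^ p := by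
  set F : ℝ → ℝ := fun x => |x| ^ (p + 2) / ((p + 1) * (p + 2)) with hF
  refine ⟨8 * F (3 / 4) - 8 * F (2 / 4) - 8 * F (1 / 4) - 2 * F 1, ?_, fun q hq => ?_⟩
  · have h := rpow_combination_pos hp0 hp1
    have e : 8 * F (3 / 4) - 8 * F (2 / 4) - 8 * F (1 / 4) - 2 * F 1 =
        2 / ((p + 1) * (p + 2)) * (4 * (3 / 4 : ℝ) ^ (p + 2) - (4 * (1 / 4 : ℝ) ^ (p + 2) +
          4 * (2 / 4) ^ (p + 2) + 1 ^ (p + 2))) := by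
      simp only [hF]
      rw [abs_of_pos (by norm_num : (0 : ℝ) < 3 / 4), abs_of_pos (by norm_num : (0 : ℝ) < 2 / 4),
        abs_of_pos (by norm_num : (0 : ℝ) < 1 / 4), abs_one]
      ring
    rw [e]
    exact mul_pos (by positivity) (sub_pos.2 h)
  · have hQ : (0 : ℝ) < (4 * q : ℕ) := by positivity
    set h : ℝ := 1 / (4 * q : ℕ) with hh
    have hh0 : 0 < h := by positivity
    set G : ℕ → ℕ → ℝ := fun i j => F (((i : ℝ) - j) * h) with hG
    have tel : ∑ i ∈ Finset.range (4 * q), ∑ j ∈ Finset.range (4 * q),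
        quarterSign q i * quarterSign q j *
          (G (i + 1) (j + 1) - G (i + 1) j - G i (j + 1) + G i j) =
        8 * F (3 / 4) - 8 * F (2 / 4) - 8 * F (1 / 4) - 2 * F 1 := by
      have inner : ∀ i, ∑ j ∈ Finset.range (4 * q), quarterSign q i * quarterSign q j *
          (G (i + 1) (j + 1) - G (i + 1) j - G i (j + 1) + G i j) = quarterSign q i *
          ((G (i + 1) 0 - 2 * G (i + 1) q + 2 * G (i + 1) (3 * q) - G (i + 1) (4 * q)) -
           (G i 0 - 2 * G i q + 2 * G i (3 * q) - G i (4 * q))) := by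
        intro i
        rw [← sum_quarterSign_mul_sub, ← sum_quarterSign_mul_sub, ← Finset.sum_sub_distrib,
          Finset.mul_sum]
        refine Finset.sum_congr rfl fun j _ => ?_
        ring
      simp only [inner]
      rw [sum_quarterSign_mul_sub q
        (fun i => G i 0 - 2 * G i q + 2 * G i (3 * q) - G i (4 * q))]
      have gen : ∀ a b c : ℕ, (a : ℝ) = b + c → G (a * q) (b * q) = F (c / 4) := by
        intro a b c habc
        simp only [hG]
        congr 1
        push_cast [hh]
        rw [habc]
        field_simp
        ring
      have gsymm : ∀ i j, G i j = G j i := by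
        intro i j
        simp only [hG, hF]
        rw [← abs_neg]
        congr 3
        ring
      have z : ∀ b : ℕ, G (b * q) 0 = F (b / 4) := by
        intro b
        simpa using gen b 0 b (by simp)
      have f0 : F 0 = 0 := by simp [hF, Real.zero_rpow (by linarith : p + 2 ≠ 0)]
      have d : ∀ i, G i i = 0 := by intro i; simp [hG, f0]
      have z1 : G q 0 = F (1 / 4) := by simpa using z 1
      have z3 : G (3 * q) 0 = F (3 / 4) := by simpa using z 3
      have z4 : G (4 * q) 0 = F 1 := by simpa using z 4
      have z31 : G (3 * q) q = F (2 / 4) := by simpa using gen 3 1 2 (by norm_num)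
      have z41 : G (4 * q) q = F (3 / 4) := by simpa using gen 4 1 3 (by norm_num)
      have z43 : G (4 * q) (3 * q) = F (1 / 4) := by simpa using gen 4 3 1 (by norm_num)
      rw [gsymm 0 q, gsymm 0 (3 * q), gsymm 0 (4 * q), gsymm q (3 * q), gsymm q (4 * q),
        gsymm (3 * q) (4 * q), d, d, d, d, z1, z3, z4, z31, z41, z43]
      ring
    rw [← tel]
    have e : quarterForm (fun x => |x| ^ p) q 0 + ∑ i ∈ Finset.range (4 * q),
        ∑ j ∈ Finset.range (4 * q), quarterSign q i * quarterSign q j *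
          (G (i + 1) (j + 1) - G (i + 1) j - G i (j + 1) + G i j) =
        h ^ 2 * ∑ i ∈ Finset.range (4 * q), ∑ j ∈ Finset.range (4 * q),
        quarterSign q i * quarterSign q j * (|((i : ℝ) - j) * h| ^ p +
          (G (i + 1) (j + 1) - G (i + 1) j - G i (j + 1) + G i j) / h ^ 2) := by
      have split : ∀ f g : ℕ → ℕ → ℝ, ∑ i ∈ Finset.range (4 * q), ∑ j ∈ Finset.range (4 * q),
          quarterSign q i * quarterSign q j * (f i j + g i j) =
          (∑ i ∈ Finset.range (4 * q), ∑ j ∈ Finset.range (4 * q),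
            quarterSign q i * quarterSign q j * f i j) +
          ∑ i ∈ Finset.range (4 * q), ∑ j ∈ Finset.range (4 * q),
            quarterSign q i * quarterSign q j * g i j := by
        intro f g
        simp only [mul_add, Finset.sum_add_distrib]
      unfold quarterForm
      rw [split (fun i j => |((i : ℝ) - j) * h| ^ p), mul_add]
      congr 1
      · rw [← hh]
        congr 1
        refine Finset.sum_congr rfl fun i _ => Finset.sum_congr rfl fun j _ => ?_
        congr 3
        rw [hh]
        ring
      · simp only [Finset.mul_sum]
        refine Finset.sum_congr rfl fun i _ => Finset.sum_congr rfl fun j _ => ?_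
        field_simp
    rw [e]
    refine abs_signed_average_le q _ _ (by positivity) fun i _ j _ => ?_
    have hx := abs_second_difference_sub_le hp0 hp1 (((i : ℝ) - j) * h) hh0
    have e3 : G (i + 1) (j + 1) - G (i + 1) j - G i (j + 1) + G i j =
        -(F (((i : ℝ) - j) * h + h) - 2 * F (((i : ℝ) - j) * h) + F (((i : ℝ) - j) * h - h)) := by
      have g1 : (((i + 1 : ℕ) : ℝ) - (j + 1 : ℕ)) * h = ((i : ℝ) - j) * h := by push_cast; ring
      have g2 : (((i + 1 : ℕ) : ℝ) - j) * h = ((i : ℝ) - j) * h + h := by push_cast; ring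
      have g3 : ((i : ℝ) - (j + 1 : ℕ)) * h = ((i : ℝ) - j) * h - h := by push_cast; ring
      simp only [hG, g1, g2, g3]
      ring
    rw [e3]
    change |F (((i : ℝ) - j) * h + h) - 2 * F (((i : ℝ) - j) * h) + F (((i : ℝ) - j) * h - h) - _|
      ≤ _ at hx
    have e4 : |((i : ℝ) - j) * h| ^ p + -(F (((i : ℝ) - j) * h + h) -
        2 * F (((i : ℝ) - j) * h) + F (((i : ℝ) - j) * h - h)) / h ^ 2 =
        -((F (((i : ℝ) - j) * h + h) - 2 * F (((i : ℝ) - j) * h) + F (((i : ℝ) - j) * h - h) -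
        h ^ 2 * |((i : ℝ) - j) * h| ^ p) / h ^ 2) := by
      field_simp
      ring
    rw [e4, abs_neg, abs_div, abs_of_pos (by positivity : 0 < h ^ 2), div_le_iff₀ (by positivity)]
    linarith

section

variable {Ω : Type*} [MeasurableSpace Ω] {P : Measure Ω}

lemma ae_bounded_of_integral_le_geometric {f : ℕ → Ω → ℝ} (hi : ∀ n, Integrable (f n) P)
    (h0 : ∀ n ω, 0 ≤ f n ω) {C r : ℝ} (hr0 : 0 ≤ r) (hr1 : r < 1)
    (h : ∀ n, ∫ ω, f n ω ∂P ≤ C * r ^ n) : ∀ᵐ ω ∂P, ∃ K, ∀ n, f n ω ≤ K := by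
  have hs : Summable fun n => ∫ ω, f n ω ∂P :=
    Summable.of_nonneg_of_le (fun n => integral_nonneg (h0 n)) h
      ((summable_geometric_of_lt_one hr0 hr1).mul_left C)
  have hfin : ∫⁻ ω, ∑' n, ENNReal.ofReal (f n ω) ∂P ≠ ⊤ := by
    rw [lintegral_tsum fun n => (hi n).aestronglyMeasurable.aemeasurable.ennreal_ofReal]
    have e : ∀ n, ∫⁻ ω, ENNReal.ofReal (f n ω) ∂P = ENNReal.ofReal (∫ ω, f n ω ∂P) := fun n =>
      (ofReal_integral_eq_lintegral_ofReal (hi n) (ae_of_all _ (h0 n))).symm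
    simp only [e]
    rw [← ENNReal.ofReal_tsum_of_nonneg (fun n => integral_nonneg (h0 n)) hs]
    exact ENNReal.ofReal_ne_top
  have hae := ae_lt_top' (AEMeasurable.tsum fun n =>
    (hi n).aestronglyMeasurable.aemeasurable.ennreal_ofReal) hfin
  filter_upwards [hae] with ω hω
  refine ⟨(∑' n, ENNReal.ofReal (f n ω)).toReal, fun n => ?_⟩
  rw [← ENNReal.ofReal_le_iff_le_toReal hω.ne]
  exact ENNReal.le_tsum n

namespace IsFBM

variable {H : ℝ} {W : ℝ → Ω → ℝ}

/-- Dyadic Hölder bound for the paths of fractional Brownian motion. -/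
lemma ae_dyadic_increment_le (hW : IsFBM P H W) (hH : 0 < H) {H' : ℝ} (hH' : H' < H) :
    ∀ᵐ ω ∂P, ∃ K : ℝ, ∀ m : ℕ, ∀ k < 2 ^ m,
      |W (((k + 1 : ℕ) : ℝ) / 2 ^ m) ω - W ((k : ℝ) / 2 ^ m) ω| ≤ K * ((2 : ℝ) ^ (-H')) ^ m := by
  obtain ⟨N, hN⟩ := exists_nat_gt (1 / (2 * (H - H')))
  have hN' : 1 < N * (2 * (H - H')) := by
    rwa [div_lt_iff₀ (by linarith)] at hN
  have hN0 : 2 * N ≠ 0 := by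
    rintro h0
    have : N = 0 := by omega
    rw [this] at hN'
    norm_num at hN'
  set M : ℝ := ∫ x, x ^ (2 * N) ∂(gaussianReal 0 1) with hM
  set D : ℕ → ℕ → Ω → ℝ := fun m k ω => W (((k + 1 : ℕ) : ℝ) / 2 ^ m) ω - W ((k : ℝ) / 2 ^ m) ω
    with hD
  have hmem : ∀ m k : ℕ, k ≤ 2 ^ m → (k : ℝ) / 2 ^ m ∈ Set.Icc (0 : ℝ) 1 := by
    intro m k hk
    refine ⟨by positivity, (div_le_one (by positivity)).2 (by exact_mod_cast hk)⟩
  have hDg : ∀ m, ∀ k < 2 ^ m, IsCenteredGaussian P (D m k) ∧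
      ∫ ω, D m k ω ^ 2 ∂P = ((2 : ℝ) ^ (-(2 * H))) ^ m := by
    intro m k hk
    have h := hW.integral_sub_sq hH (hmem m (k + 1) hk) (hmem m k hk.le)
    refine ⟨h.1, h.2.trans ?_⟩
    have e : ((k + 1 : ℕ) : ℝ) / 2 ^ m - (k : ℝ) / 2 ^ m = (2 : ℝ) ^ (-(m : ℝ)) := by
      rw [Real.rpow_neg (by norm_num), Real.rpow_natCast]
      push_cast
      field_simp
      ring
    rw [e, abs_of_pos (by positivity), ← Real.rpow_mul (by norm_num), ← Real.rpow_natCast,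
      ← Real.rpow_mul (by norm_num)]
    congr 1
    ring
  set c : ℝ := (2 : ℝ) ^ (2 * N * H') with hc
  have hc0 : 0 < c := by positivity
  have key := ae_bounded_of_integral_le_geometric (P := P)
    (f := fun m ω => (∑ k ∈ Finset.range (2 ^ m), D m k ω ^ (2 * N)) * c ^ m)
    (C := M) (r := (2 : ℝ) ^ (1 - N * (2 * (H - H')))) ?_ ?_ (by positivity) ?_ ?_
  · filter_upwards [key] with ω hω
    obtain ⟨K, hK⟩ := hω
    refine ⟨(max K 1) ^ (1 / (2 * N : ℕ) : ℝ), fun m k hk => ?_⟩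
    have h1 : D m k ω ^ (2 * N) * c ^ m ≤ max K 1 := by
      refine le_trans ?_ ((hK m).trans (le_max_left _ _))
      refine mul_le_mul_of_nonneg_right ?_ (by positivity)
      exact Finset.single_le_sum (f := fun k => D m k ω ^ (2 * N))
        (fun i _ => by rw [pow_mul]; positivity) (Finset.mem_range.2 hk)
    have hK0 : 0 ≤ max K 1 := le_trans zero_le_one (le_max_right _ _)
    refine le_of_pow_le_pow_left₀ hN0 (by positivity) ?_
    have e1 : (max K 1 ^ (1 / (2 * N : ℕ) : ℝ)) ^ (2 * N) = max K 1 := by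
      rw [← Real.rpow_natCast, ← Real.rpow_mul hK0, one_div, inv_mul_cancel₀, Real.rpow_one]
      exact_mod_cast hN0
    have e2 : (((2 : ℝ) ^ (-H')) ^ m) ^ (2 * N) * c ^ m = 1 := by
      have h2 : ((2 : ℝ) ^ (-H')) ^ (2 * N) * c = 1 := by
        rw [hc, ← Real.rpow_natCast, ← Real.rpow_mul (by norm_num), ← Real.rpow_add (by norm_num)]
        have : -H' * ((2 * N : ℕ) : ℝ) + 2 * N * H' = 0 := by push_cast; ring
        rw [this, Real.rpow_zero]
      rw [← pow_mul, mul_comm m, pow_mul, ← mul_pow, h2, one_pow]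
    rw [mul_pow, e1, pow_mul, sq_abs, ← pow_mul]
    have hcm : 0 < c ^ m := by positivity
    refine le_of_mul_le_mul_right ?_ hcm
    rw [mul_assoc, e2, mul_one]
    exact h1
  · intro m
    exact (integrable_finsetSum _ fun k hk =>
      (hDg m k (Finset.mem_range.1 hk)).1.integrable_pow _).mul_const _
  · intro m ω
    refine mul_nonneg (Finset.sum_nonneg fun k _ => ?_) (by positivity)
    rw [pow_mul]; positivity
  · exact Real.rpow_lt_one_of_one_lt_of_neg (by norm_num) (by linarith)
  · intro m
    rw [integral_mul_const, integral_finsetSum _ fun k hk =>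
      (hDg m k (Finset.mem_range.1 hk)).1.integrable_pow _]
    have e : ∀ k ∈ Finset.range (2 ^ m), ∫ ω, D m k ω ^ (2 * N) ∂P =
        (((2 : ℝ) ^ (-(2 * H))) ^ m) ^ N * M := by
      intro k hk
      have h := hDg m k (Finset.mem_range.1 hk)
      rw [h.1.integral_pow_even, h.2]
    rw [Finset.sum_congr rfl e, Finset.sum_const, Finset.card_range, nsmul_eq_mul]
    refine le_of_eq ?_
    have e3 : ((2 : ℝ) ^ (1 - N * (2 * (H - H')))) = 2 * ((2 : ℝ) ^ (-(2 * H))) ^ N * c := by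
      have h2 : 1 - N * (2 * (H - H')) = 1 + -(2 * H) * N + 2 * N * H' := by ring
      rw [hc, h2, Real.rpow_add (by norm_num), Real.rpow_add (by norm_num), Real.rpow_one,
        Real.rpow_mul (by norm_num), Real.rpow_natCast]
    rw [e3]
    push_cast
    rw [mul_pow, mul_pow, ← pow_mul, ← pow_mul, mul_comm N m]
    ring

end IsFBM

end

/-- Chaining: a bound on dyadic increments gives a modulus of continuity at dyadic points. -/
lemma abs_sub_dyadic_le {f : ℝ → ℝ} (hf : ContinuousOn f (Set.Icc 0 1)) {K r : ℝ} (hr0 : 0 < r)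
    (hr1 : r < 1) (h : ∀ m : ℕ, ∀ k < 2 ^ m,
      |f (((k + 1 : ℕ) : ℝ) / 2 ^ m) - f ((k : ℝ) / 2 ^ m)| ≤ K * r ^ m)
    {n k : ℕ} (hk : k < 2 ^ n) {t : ℝ} (ht0 : (k : ℝ) / 2 ^ n ≤ t)
    (ht1 : t ≤ ((k : ℝ) + 1) / 2 ^ n) :
    |f t - f ((k : ℝ) / 2 ^ n)| ≤ K * (1 / (1 - r)) * r ^ n := by
  have hK : 0 ≤ K := by
    have h0 := (abs_nonneg _).trans (h 0 0 (by norm_num))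
    simpa using h0
  have hgeo : ∀ d : ℕ, ∑ i ∈ Finset.range d, r ^ i ≤ 1 / (1 - r) := by
    intro d
    rw [one_div, ← tsum_geometric_of_lt_one hr0.le hr1]
    exact (summable_geometric_of_lt_one hr0.le hr1).sum_le_tsum _ fun i _ => by positivity
  have dy : ∀ d i : ℕ, i ≤ 2 ^ d → |f (((k * 2 ^ d + i : ℕ) : ℝ) / 2 ^ (n + d)) -
      f ((k : ℝ) / 2 ^ n)| ≤ K * r ^ n * ∑ i ∈ Finset.range (d + 1), r ^ i := by
    intro d
    induction d with
    | zero =>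
      intro i hi
      have hn := h n k hk
      rcases Nat.le_one_iff_eq_zero_or_eq_one.1 (by simpa using hi) with rfl | rfl
      · simp only [pow_zero, mul_one, add_zero, sub_self, abs_zero]
        positivity
      · simpa using hn
    | succ d ih =>
      intro i hi
      have half : ∀ j : ℕ, (((k * 2 ^ (d + 1) + 2 * j : ℕ) : ℝ) / 2 ^ (n + (d + 1))) =
          ((k * 2 ^ d + j : ℕ) : ℝ) / 2 ^ (n + d) := by
        intro j
        push_cast
        rw [← add_assoc, pow_succ 2 (n + d), pow_succ 2 d]
        field_simp
      have mono : ∑ i ∈ Finset.range (d + 1), r ^ i ≤ ∑ i ∈ Finset.range (d + 1 + 1), r ^ i := by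
        rw [Finset.sum_range_succ _ (d + 1)]
        linarith [pow_pos hr0 (d + 1)]
      rcases Nat.even_or_odd' i with ⟨j, rfl | rfl⟩
      · rw [half]
        refine (ih j (by rw [pow_succ] at hi; omega)).trans ?_
        exact mul_le_mul_of_nonneg_left mono (by positivity)
      · have hj : j < 2 ^ d := by rw [pow_succ] at hi; omega
        have h1 := ih j hj.le
        have h2 := h (n + (d + 1)) (k * 2 ^ (d + 1) + 2 * j) (by
          have : k * 2 ^ (d + 1) + 2 ^ (d + 1) ≤ 2 ^ n * 2 ^ (d + 1) := by
            rw [← Nat.succ_mul]; exact Nat.mul_le_mul_right _ hk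
          rw [pow_add 2 n (d + 1)]
          have e : 2 ^ (d + 1) = 2 * 2 ^ d := by ring
          generalize 2 ^ n * 2 ^ (d + 1) = A at *
          generalize k * 2 ^ (d + 1) = B at *
          omega)
        rw [half] at h2
        rw [Finset.sum_range_succ _ (d + 1), mul_add, ← add_assoc]
        have h3 := abs_sub_le (f (((k * 2 ^ (d + 1) + 2 * j + 1 : ℕ) : ℝ) / 2 ^ (n + (d + 1))))
          (f (((k * 2 ^ d + j : ℕ) : ℝ) / 2 ^ (n + d))) (f ((k : ℝ) / 2 ^ n))
        have e : K * r ^ (n + (d + 1)) = K * r ^ n * r ^ (d + 1) := by rw [pow_add]; ring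
        rw [e] at h2
        linarith
  have htm : t ∈ Set.Icc (0 : ℝ) 1 := by
    refine ⟨le_trans (by positivity) ht0, ht1.trans ((div_le_one (by positivity)).2 ?_)⟩
    exact_mod_cast hk
  set s : ℝ := t * 2 ^ n - k with hs
  have hs0 : 0 ≤ s := by
    rw [div_le_iff₀ (by positivity)] at ht0
    linarith
  have hs1 : s ≤ 1 := by
    rw [le_div_iff₀ (by positivity)] at ht1
    linarith
  have hi : ∀ d : ℕ, ⌊s * 2 ^ d⌋₊ ≤ 2 ^ d := by
    intro d
    have : s * 2 ^ d ≤ (2 ^ d : ℕ) := by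
      push_cast
      exact mul_le_of_le_one_left (by positivity) hs1
    exact_mod_cast (Nat.floor_le (by positivity)).trans this
  have ub : ∀ d : ℕ, ((k * 2 ^ d + ⌊s * 2 ^ d⌋₊ : ℕ) : ℝ) / 2 ^ (n + d) ≤ t := by
    intro d
    rw [div_le_iff₀ (by positivity)]
    push_cast
    have := Nat.floor_le (by positivity : 0 ≤ s * 2 ^ d)
    have e : t * 2 ^ (n + d) = k * 2 ^ d + s * 2 ^ d := by rw [hs, pow_add]; ring
    linarith
  have lb : ∀ d : ℕ, t - (1 / 2) ^ d ≤ ((k * 2 ^ d + ⌊s * 2 ^ d⌋₊ : ℕ) : ℝ) / 2 ^ (n + d) := by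
    intro d
    rw [le_div_iff₀ (by positivity)]
    push_cast
    have := (Nat.lt_floor_add_one (s * 2 ^ d)).le
    have e : (t - (1 / 2) ^ d) * 2 ^ (n + d) = k * 2 ^ d + s * 2 ^ d - 2 ^ n := by
      rw [hs, pow_add, one_div, inv_pow]; field_simp; ring
    have e2 : (1 : ℝ) ≤ 2 ^ n := one_le_pow₀ (by norm_num)
    linarith
  have hlim : Tendsto (fun d : ℕ => ((k * 2 ^ d + ⌊s * 2 ^ d⌋₊ : ℕ) : ℝ) / 2 ^ (n + d)) atTop
      (nhds t) := by
    refine tendsto_of_tendsto_of_tendsto_of_le_of_le ?_ tendsto_const_nhds lb ub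
    have h1 : Tendsto (fun d : ℕ => (1 / 2 : ℝ) ^ d) atTop (nhds 0) :=
      tendsto_pow_atTop_nhds_zero_of_lt_one (by norm_num) (by norm_num)
    simpa using h1.const_sub t
  have hlim2 : Tendsto (fun d : ℕ => |f (((k * 2 ^ d + ⌊s * 2 ^ d⌋₊ : ℕ) : ℝ) / 2 ^ (n + d)) -
      f ((k : ℝ) / 2 ^ n)|) atTop (nhds |f t - f ((k : ℝ) / 2 ^ n)|) := by
    refine (Tendsto.sub_const ?_ _).abs
    refine (hf t htm).tendsto.comp (tendsto_nhdsWithin_iff.2 ⟨hlim, ?_⟩)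
    exact Eventually.of_forall fun d => ⟨by positivity, (ub d).trans htm.2⟩
  refine le_of_tendsto hlim2 (Eventually.of_forall fun d => ?_)
  refine (dy d _ (hi d)).trans ?_
  have := mul_le_mul_of_nonneg_left (hgeo (d + 1)) (by positivity : 0 ≤ K * r ^ n)
  linarith

/-- The mean square over dyadic blocks of length `2 ^ d` of the block averages of `x`. -/
noncomputable def blockVar (x : ℕ → ℝ) (j d : ℕ) : ℝ :=
  (1 / 2 ^ j) * ∑ b ∈ Finset.range (2 ^ j),
    ((1 / 2 ^ d) * ∑ l ∈ Finset.range (2 ^ d), x (b * 2 ^ d + l)) ^ 2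

/-- The rescaled local signed average of the path `w` over the `k`-th dyadic interval of
generation `n`. -/
noncomputable def signedAverage (H : ℝ) (w : ℝ → ℝ) (n k : ℕ) : ℝ :=
  (2 : ℝ) ^ (n * H + 3) / (4 * 2 ^ n : ℕ) * ∑ i ∈ Finset.range (4 * 2 ^ n),
    quarterSign (2 ^ n) i * w ((k + i / (4 * 2 ^ n : ℕ)) / 2 ^ n)

lemma fbmCov_div {H a b : ℝ} (ha : 0 ≤ a) (hb : 0 ≤ b) (n : ℕ) :
    fbmCov H (a / 2 ^ n) (b / 2 ^ n) = (2 : ℝ) ^ (-(2 * n * H)) * fbmCov H a b := by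
  have e : ((2 : ℝ) ^ n) ^ (2 * H) = (2 : ℝ) ^ (2 * n * H) := by
    rw [← Real.rpow_natCast, ← Real.rpow_mul (by norm_num)]
    congr 1
    ring
  unfold fbmCov
  rw [← sub_div, abs_div, abs_of_pos (by positivity : (0 : ℝ) < 2 ^ n),
    Real.div_rpow ha (by positivity), Real.div_rpow hb (by positivity),
    Real.div_rpow (abs_nonneg _) (by positivity), e, Real.rpow_neg (by norm_num)]
  ring

lemma sum_quarterSign_mul_fbmCov (H : ℝ) (n k l : ℕ) :
    ∑ i ∈ Finset.range (4 * 2 ^ n), ∑ j ∈ Finset.range (4 * 2 ^ n),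
      ((2 : ℝ) ^ (n * H + 3) / (4 * 2 ^ n : ℕ) * quarterSign (2 ^ n) i) *
      ((2 : ℝ) ^ (n * H + 3) / (4 * 2 ^ n : ℕ) * quarterSign (2 ^ n) j) *
      fbmCov H ((k + i / (4 * 2 ^ n : ℕ)) / 2 ^ n) ((l + j / (4 * 2 ^ n : ℕ)) / 2 ^ n) =
    -32 * quarterForm (fun x => |x| ^ (2 * H)) (2 ^ n) ((k : ℝ) - l) := by
  set Q : ℝ := ((4 * 2 ^ n : ℕ) : ℝ) with hQ
  set s : ℕ → ℝ := quarterSign (2 ^ n) with hs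
  have hs0 : ∑ i ∈ Finset.range (4 * 2 ^ n), s i = 0 := sum_quarterSign _
  have h2 : ((2 : ℝ) ^ (n * H + 3)) ^ 2 * (2 : ℝ) ^ (-(2 * n * H)) = 64 := by
    rw [← Real.rpow_natCast, ← Real.rpow_mul (by norm_num), ← Real.rpow_add (by norm_num)]
    have : (n * H + 3) * ((2 : ℕ) : ℝ) + -(2 * n * H) = ((6 : ℕ) : ℝ) := by push_cast; ring
    rw [this, Real.rpow_natCast]
    norm_num
  have e : ∀ i j : ℕ, ((2 : ℝ) ^ (n * H + 3) / Q * s i) * ((2 : ℝ) ^ (n * H + 3) / Q * s j) *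
      fbmCov H ((k + i / Q) / 2 ^ n) ((l + j / Q) / 2 ^ n) =
      32 * (1 / Q) ^ 2 * (s j * (s i * (k + i / Q) ^ (2 * H))) +
      32 * (1 / Q) ^ 2 * (s i * (s j * (l + j / Q) ^ (2 * H))) -
      32 * (1 / Q) ^ 2 * (s i * s j * |(k : ℝ) - l + (i / Q - j / Q)| ^ (2 * H)) := by
    intro i j
    have ea : (k : ℝ) + i / Q - (l + j / Q) = (k : ℝ) - l + (i / Q - j / Q) := by ring
    rw [fbmCov_div (by positivity) (by positivity), fbmCov, ea]
    have h3 : ((2 : ℝ) ^ (n * H + 3) / Q * s i) * ((2 : ℝ) ^ (n * H + 3) / Q * s j) =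
      ((2 : ℝ) ^ (n * H + 3)) ^ 2 * ((1 / Q) ^ 2 * (s i * s j)) := by ring
    rw [h3]
    linear_combination (((1 / Q) ^ 2 * (s i * s j)) * (((k + i / Q) ^ (2 * H) +
      (l + j / Q) ^ (2 * H) - |(k : ℝ) - l + (i / Q - j / Q)| ^ (2 * H)) / 2)) * h2
  simp only [e, Finset.sum_sub_distrib, Finset.sum_add_distrib, ← Finset.mul_sum, ← Finset.sum_mul,
    hs0]
  unfold quarterForm
  simp only [zero_mul, mul_zero]
  ring

section

variable {Ω : Type*} [MeasurableSpace Ω] {P : Measure Ω} {H : ℝ} {W : ℝ → Ω → ℝ}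

lemma signedAverage_eq_sum_fin (H : ℝ) (w : ℝ → ℝ) (n k : ℕ) :
    signedAverage H w n k = ∑ i : Fin (4 * 2 ^ n),
      ((2 : ℝ) ^ (n * H + 3) / (4 * 2 ^ n : ℕ) * quarterSign (2 ^ n) i) *
        w ((k + (i : ℕ) / (4 * 2 ^ n : ℕ)) / 2 ^ n) := by
  rw [signedAverage, Finset.mul_sum, Finset.sum_range]
  exact Finset.sum_congr rfl fun i _ => by ring

lemma sample_mem_Icc {n k i : ℕ} (hk : k < 2 ^ n) (hi : i < 4 * 2 ^ n) :
    ((k : ℝ) + i / (4 * 2 ^ n : ℕ)) / 2 ^ n ∈ Set.Icc (0 : ℝ) 1 := by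
  have hQ : (0 : ℝ) < (4 * 2 ^ n : ℕ) := by positivity
  refine ⟨by positivity, (div_le_one (by positivity)).2 ?_⟩
  have h1 : (i : ℝ) / (4 * 2 ^ n : ℕ) ≤ 1 := (div_le_one hQ).2 (by exact_mod_cast hi.le)
  have h2 : (k : ℝ) + 1 ≤ 2 ^ n := by exact_mod_cast hk
  linarith

namespace IsFBM

lemma isCenteredGaussian_signedAverage (hW : IsFBM P H W) (hH : 0 < H) {n k : ℕ}
    (hk : k < 2 ^ n) :
    IsCenteredGaussian P (fun ω => signedAverage H (fun t => W t ω) n k) := by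
  simp only [signedAverage_eq_sum_fin]
  exact hW.isCenteredGaussian_sum hH _ _ fun i => sample_mem_Icc hk i.2

lemma integral_signedAverage_sq (hW : IsFBM P H W) (hH : 0 < H) {n k : ℕ} (hk : k < 2 ^ n) :
    ∫ ω, signedAverage H (fun t => W t ω) n k ^ 2 ∂P =
      -32 * quarterForm (fun x => |x| ^ (2 * H)) (2 ^ n) 0 := by
  simp only [signedAverage_eq_sum_fin, sq]
  rw [hW.integral_sum_mul_sum hH _ _ _ _ (fun i => sample_mem_Icc hk i.2)
    (fun i => sample_mem_Icc hk i.2)]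
  have h := sum_quarterSign_mul_fbmCov H n k k
  simp only [Finset.sum_range, sub_self] at h
  exact h

lemma integral_signedAverage_sq_mul_sq (hW : IsFBM P H W) (hH : 0 < H) {n k l : ℕ}
    (hk : k < 2 ^ n) (hl : l < 2 ^ n) :
    ∫ ω, signedAverage H (fun t => W t ω) n k ^ 2 * signedAverage H (fun t => W t ω) n l ^ 2 ∂P =
      (-32 * quarterForm (fun x => |x| ^ (2 * H)) (2 ^ n) 0) ^ 2 +
        2048 * quarterForm (fun x => |x| ^ (2 * H)) (2 ^ n) ((k : ℝ) - l) ^ 2 := by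
  have h1 := hW.integral_signedAverage_sq hH hk
  have h2 := hW.integral_signedAverage_sq hH hl
  simp only [signedAverage_eq_sum_fin] at h1 h2 ⊢
  rw [hW.integral_sum_sq_mul_sum_sq hH _ _ _ _ (fun i => sample_mem_Icc hk i.2)
    (fun i => sample_mem_Icc hl i.2), h1, h2]
  have h := sum_quarterSign_mul_fbmCov H n k l
  simp only [Finset.sum_range] at h
  rw [h]
  ring

lemma integral_sq_sum_le [IsProbabilityMeasure P] (hW : IsFBM P H W)
    (hH : H ∈ Set.Ioo (0 : ℝ) (1 / 2)) {n s L : ℕ} (hs : s + L ≤ 2 ^ n) :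
    Integrable (fun ω => (∑ l ∈ Finset.range L, (signedAverage H (fun t => W t ω) n (s + l) ^ 2 -
      -32 * quarterForm (fun x => |x| ^ (2 * H)) (2 ^ n) 0)) ^ 2) P ∧
    ∫ ω, (∑ l ∈ Finset.range L, (signedAverage H (fun t => W t ω) n (s + l) ^ 2 -
      -32 * quarterForm (fun x => |x| ^ (2 * H)) (2 ^ n) 0)) ^ 2 ∂P ≤ 8192 * (L : ℝ) := by
  set V : ℝ := -32 * quarterForm (fun x => |x| ^ (2 * H)) (2 ^ n) 0 with hV
  set Z : ℕ → Ω → ℝ := fun l ω => signedAverage H (fun t => W t ω) n (s + l) with hZ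
  have hlt : ∀ l ∈ Finset.range L, s + l < 2 ^ n := fun l hl => by
    rw [Finset.mem_range] at hl; omega
  have hg : ∀ l ∈ Finset.range L, IsCenteredGaussian P (Z l) := fun l hl =>
    hW.isCenteredGaussian_signedAverage hH.1 (hlt l hl)
  have hm2 : ∀ l ∈ Finset.range L, ∫ ω, Z l ω ^ 2 ∂P = V := fun l hl =>
    hW.integral_signedAverage_sq hH.1 (hlt l hl)
  have e : ∀ ω, (∑ l ∈ Finset.range L, (Z l ω ^ 2 - V)) ^ 2 = ∑ k ∈ Finset.range L,
      ∑ l ∈ Finset.range L, (Z k ω ^ 2 * Z l ω ^ 2 - V * Z k ω ^ 2 - V * Z l ω ^ 2 + V ^ 2) := by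
    intro ω
    rw [sq, Finset.sum_mul_sum]
    exact Finset.sum_congr rfl fun k _ => Finset.sum_congr rfl fun l _ => by ring
  have i4 : ∀ k ∈ Finset.range L, ∀ l ∈ Finset.range L,
      Integrable (fun ω => Z k ω ^ 2 * Z l ω ^ 2) P := fun k hk l hl =>
    (hg k hk).integrable_sq_mul_sq (hg l hl)
  have i2 : ∀ k ∈ Finset.range L, Integrable (fun ω => V * Z k ω ^ 2) P := fun k hk =>
    ((hg k hk).integrable_pow 2).const_mul V
  have ia : ∀ k ∈ Finset.range L, ∀ l ∈ Finset.range L, Integrable (fun ω =>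
      Z k ω ^ 2 * Z l ω ^ 2 - V * Z k ω ^ 2 - V * Z l ω ^ 2 + V ^ 2) P := fun k hk l hl =>
    (((i4 k hk l hl).sub (i2 k hk)).sub (i2 l hl)).add (integrable_const _)
  change Integrable (fun ω => (∑ l ∈ Finset.range L, (Z l ω ^ 2 - V)) ^ 2) P ∧
    ∫ ω, (∑ l ∈ Finset.range L, (Z l ω ^ 2 - V)) ^ 2 ∂P ≤ 8192 * (L : ℝ)
  simp only [e]
  refine ⟨integrable_finsetSum _ fun k hk => integrable_finsetSum _ fun l hl => ia k hk l hl, ?_⟩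
  rw [integral_finsetSum _ fun k hk => integrable_finsetSum _ fun l hl => ia k hk l hl]
  have hk : ∀ k ∈ Finset.range L, ∫ ω, ∑ l ∈ Finset.range L,
      (Z k ω ^ 2 * Z l ω ^ 2 - V * Z k ω ^ 2 - V * Z l ω ^ 2 + V ^ 2) ∂P ≤ 8192 := by
    intro k hk
    rw [integral_finsetSum _ fun l hl => ia k hk l hl]
    have hl : ∀ l ∈ Finset.range L, ∫ ω,
        (Z k ω ^ 2 * Z l ω ^ 2 - V * Z k ω ^ 2 - V * Z l ω ^ 2 + V ^ 2) ∂P =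
        2048 * quarterForm (fun x => |x| ^ (2 * H)) (2 ^ n) ((k : ℝ) - l) ^ 2 := by
      intro l hl
      have j1 : Integrable (fun ω => Z k ω ^ 2 * Z l ω ^ 2 - V * Z k ω ^ 2) P :=
        (i4 k hk l hl).sub (i2 k hk)
      have j2 : Integrable (fun ω => Z k ω ^ 2 * Z l ω ^ 2 - V * Z k ω ^ 2 - V * Z l ω ^ 2) P :=
        j1.sub (i2 l hl)
      rw [integral_add j2 (integrable_const _), integral_sub j1 (i2 l hl),
        integral_sub (i4 k hk l hl) (i2 k hk), integral_const_mul, integral_const_mul,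
        hm2 k hk, hm2 l hl,
        hW.integral_signedAverage_sq_mul_sq hH.1 (hlt k hk) (hlt l hl)]
      simp only [integral_const, probReal_univ, one_smul]
      push_cast
      rw [add_sub_add_left_eq_sub]
      ring
    rw [Finset.sum_congr rfl hl, ← Finset.mul_sum]
    have := sum_quarterForm_sq_le (p := 2 * H) (by linarith [hH.1]) (by linarith [hH.2]) (2 ^ n)
      (Finset.mem_range.1 hk)
    linarith
  refine (Finset.sum_le_sum hk).trans ?_
  simp [mul_comm]

/-- Almost sure bound for the block averages of the centred squares. -/
lemma ae_blockVar_le [IsProbabilityMeasure P] (hW : IsFBM P H W)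
    (hH : H ∈ Set.Ioo (0 : ℝ) (1 / 2)) {θ : ℝ} (hθ : θ < 1 - H) (j : ℕ → ℕ)
    (hj : ∀ n, j n ≤ n) (hjθ : ∀ n, (j n : ℝ) ≤ θ * n) :
    ∀ᵐ ω ∂P, ∃ K : ℝ, ∀ n, blockVar (fun k => signedAverage H (fun t => W t ω) n k ^ 2 -
      -32 * quarterForm (fun x => |x| ^ (2 * H)) (2 ^ n) 0) (j n) (n - j n) ≤
        K * ((2 : ℝ) ^ (-H)) ^ n := by
  set V : ℕ → ℝ := fun n => -32 * quarterForm (fun x => |x| ^ (2 * H)) (2 ^ n) 0 with hV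
  set x : ℕ → Ω → ℕ → ℝ := fun n ω k => signedAverage H (fun t => W t ω) n k ^ 2 - V n with hx
  have hb : ∀ n b, b < 2 ^ j n → b * 2 ^ (n - j n) + 2 ^ (n - j n) ≤ 2 ^ n := by
    intro n b hb
    have e : 2 ^ n = 2 ^ j n * 2 ^ (n - j n) := by
      rw [← pow_add, Nat.add_sub_cancel' (hj n)]
    rw [e, ← Nat.succ_mul]
    exact Nat.mul_le_mul_right _ hb
  have hI : ∀ n, ∀ b ∈ Finset.range (2 ^ j n), Integrable (fun ω => ((1 / 2 ^ (n - j n)) *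
      ∑ l ∈ Finset.range (2 ^ (n - j n)), x n ω (b * 2 ^ (n - j n) + l)) ^ 2) P := by
    intro n b hbn
    simp only [mul_pow]
    exact (hW.integral_sq_sum_le hH (hb n b (Finset.mem_range.1 hbn))).1.const_mul _
  have key := ae_bounded_of_integral_le_geometric (P := P)
    (f := fun n ω => blockVar (x n ω) (j n) (n - j n) * ((2 : ℝ) ^ H) ^ n)
    (C := 8192) (r := (2 : ℝ) ^ (θ + H - 1)) ?_ ?_ (by positivity) ?_ ?_
  · filter_upwards [key] with ω hω
    obtain ⟨K, hK⟩ := hω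
    refine ⟨K, fun n => ?_⟩
    rw [Real.rpow_neg (by norm_num), inv_pow, ← div_eq_mul_inv, le_div_iff₀ (by positivity)]
    exact hK n
  · intro n
    unfold blockVar
    exact ((integrable_finsetSum _ (hI n)).const_mul _).mul_const _
  · intro n ω
    unfold blockVar
    positivity
  · exact Real.rpow_lt_one_of_one_lt_of_neg (by norm_num) (by linarith)
  · intro n
    rw [integral_mul_const]
    have hB : ∫ ω, blockVar (x n ω) (j n) (n - j n) ∂P ≤ 8192 / 2 ^ (n - j n) := by
      unfold blockVar
      rw [integral_const_mul, integral_finsetSum _ (hI n)]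
      have h1 : ∀ b ∈ Finset.range (2 ^ j n), ∫ ω, ((1 / 2 ^ (n - j n)) *
          ∑ l ∈ Finset.range (2 ^ (n - j n)), x n ω (b * 2 ^ (n - j n) + l)) ^ 2 ∂P ≤
          8192 / 2 ^ (n - j n) := by
        intro b hbn
        simp only [mul_pow]
        rw [integral_const_mul]
        have h2 := (hW.integral_sq_sum_le hH (hb n b (Finset.mem_range.1 hbn))).2
        refine (mul_le_mul_of_nonneg_left h2 (by positivity)).trans (le_of_eq ?_)
        push_cast
        field_simp
      refine (mul_le_mul_of_nonneg_left (Finset.sum_le_sum h1) (by positivity)).trans (le_of_eq ?_)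
      rw [Finset.sum_const, Finset.card_range, nsmul_eq_mul]
      push_cast
      field_simp
    refine (mul_le_mul_of_nonneg_right hB (by positivity)).trans ?_
    rw [div_mul_eq_mul_div, mul_div_assoc]
    refine mul_le_mul_of_nonneg_left ?_ (by norm_num)
    rw [← Real.rpow_natCast, ← Real.rpow_natCast, ← Real.rpow_natCast,
      ← Real.rpow_mul (by norm_num),
      ← Real.rpow_mul (by norm_num), ← Real.rpow_sub (by norm_num), Nat.cast_sub (hj n)]
    refine Real.rpow_le_rpow_of_exponent_le (by norm_num) ?_
    linarith [hjθ n]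

end IsFBM

end

lemma Real.abs_exp_sub_one_sub_le (u : ℝ) : |Real.exp u - 1 - u| ≤ u ^ 2 * Real.exp |u| := by
  have h := Complex.norm_exp_sub_sum_le_norm_mul_exp (u : ℂ) 2
  simp only [Finset.sum_range_succ, Finset.sum_range_zero] at h
  norm_num at h
  rw [← sub_sub] at h
  rw [← Real.norm_eq_abs (Real.exp u - 1 - u), ← Complex.norm_real]
  push_cast
  exact h

/-- Linearisation of `exp (2 x)` along a path with the same fluctuations as `w`. -/
lemma abs_exp_sub_linear_le {x x₀ δ B κ e : ℝ} (hx : |x| ≤ B) (hx₀ : |x₀| ≤ B)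
    (hκ : |x - x₀| ≤ κ) (he : |x - x₀ - δ| ≤ e) :
    |Real.exp (2 * x) - (Real.exp (2 * x₀) + 2 * Real.exp (2 * x₀) * δ)| ≤
      Real.exp (2 * B) * (4 * κ ^ 2 * Real.exp (4 * B) + 2 * e) := by
  have hE : Real.exp (2 * x₀) ≤ Real.exp (2 * B) :=
    Real.exp_le_exp.2 (by linarith [(abs_le.1 hx₀).2])
  have e1 : Real.exp (2 * x) - (Real.exp (2 * x₀) + 2 * Real.exp (2 * x₀) * δ) =
      Real.exp (2 * x₀) * ((Real.exp (2 * (x - x₀)) - 1 - 2 * (x - x₀)) + 2 * (x - x₀ - δ)) := by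
    have : Real.exp (2 * x) = Real.exp (2 * x₀) * Real.exp (2 * (x - x₀)) := by
      rw [← Real.exp_add]; congr 1; ring
    rw [this]; ring
  have h1 := Real.abs_exp_sub_one_sub_le (2 * (x - x₀))
  have h2 : |2 * (x - x₀)| ≤ 4 * B := by
    rw [abs_mul, abs_two]
    have := abs_sub x x₀
    linarith
  have h3 : (2 * (x - x₀)) ^ 2 ≤ 4 * κ ^ 2 := by
    have := sq_le_sq' (by linarith [abs_nonneg (x - x₀), neg_abs_le (x - x₀)])
      ((le_abs_self _).trans hκ)
    nlinarith
  have h4 : (2 * (x - x₀)) ^ 2 * Real.exp |2 * (x - x₀)| ≤ 4 * κ ^ 2 * Real.exp (4 * B) :=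
    mul_le_mul h3 (Real.exp_le_exp.2 h2) (by positivity) (by positivity)
  rw [e1, abs_mul, Real.abs_exp]
  refine mul_le_mul hE ?_ (abs_nonneg _) (by positivity)
  refine (abs_add_le _ _).trans ?_
  rw [abs_mul 2, abs_two]
  linarith

lemma abs_integral_sub_mul_le {f : ℝ → ℝ} {s t c e : ℝ} (hst : s ≤ t)
    (hf : IntervalIntegrable f volume s t) (h : ∀ u ∈ Set.Icc s t, |f u - c| ≤ e) :
    |(∫ u in s..t, f u) - (t - s) * c| ≤ (t - s) * e := by
  have e1 : (∫ u in s..t, f u) - (t - s) * c = ∫ u in s..t, (f u - c) := by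
    rw [intervalIntegral.integral_sub hf intervalIntegrable_const,
      intervalIntegral.integral_const, smul_eq_mul]
  rw [e1]
  have := intervalIntegral.norm_integral_le_of_norm_le_const (f := fun u => f u - c) (C := e)
    (a := s) (b := t) fun u hu => by
      rw [Set.uIoc_of_le hst] at hu
      exact h u ⟨hu.1.le, hu.2⟩
  rw [Real.norm_eq_abs, abs_of_nonneg (sub_nonneg.2 hst)] at this
  linarith

lemma div_two_pow_mem_Icc {n k : ℕ} (hk : k < 2 ^ n) {t : ℝ} (h0 : (k : ℝ) / 2 ^ n ≤ t)
    (h1 : t ≤ ((k : ℝ) + 1) / 2 ^ n) : t ∈ Set.Icc (0 : ℝ) 1 := by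
  refine ⟨le_trans (by positivity) h0, h1.trans ((div_le_one (by positivity)).2 ?_)⟩
  exact_mod_cast hk

/-- Local linearisation: quarter differences of the integral of `exp (2 x)` are, up to a
small error, proportional to the signed averages of the driving path. -/
lemma exists_quarter_difference_sub_le {w x : ℝ → ℝ} {K r Λ B : ℝ} (H : ℝ)
    (hr : 1 / 2 ≤ r ^ 2) (hr0 : 0 < r) (hr1 : r ≤ 1)
    (hx : ContinuousOn x (Set.Icc 0 1)) (hB : ∀ t ∈ Set.Icc (0 : ℝ) 1, |x t| ≤ B)
    (hw : ∀ n k : ℕ, k < 2 ^ n → ∀ t : ℝ, (k : ℝ) / 2 ^ n ≤ t → t ≤ ((k : ℝ) + 1) / 2 ^ n →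
      |w t - w ((k : ℝ) / 2 ^ n)| ≤ K * r ^ n)
    (hΛ : ∀ s ∈ Set.Icc (0 : ℝ) 1, ∀ t ∈ Set.Icc (0 : ℝ) 1,
      |(x t - x s) - (w t - w s)| ≤ Λ * |t - s|) :
    ∃ C : ℝ, 0 ≤ C ∧ ∀ n k : ℕ, k < 2 ^ n →
      |(2 : ℝ) ^ (n + n * H + 3) *
        ((∫ s in (0 : ℝ)..(4 * k) / 2 ^ (n + 2), Real.exp (2 * x s)) -
          2 * (∫ s in (0 : ℝ)..(4 * k + 1) / 2 ^ (n + 2), Real.exp (2 * x s)) +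
          2 * (∫ s in (0 : ℝ)..(4 * k + 3) / 2 ^ (n + 2), Real.exp (2 * x s)) -
          (∫ s in (0 : ℝ)..(4 * k + 4) / 2 ^ (n + 2), Real.exp (2 * x s))) -
        2 * Real.exp (2 * x (k / 2 ^ n)) * signedAverage H w n k| ≤
      C * ((2 : ℝ) ^ H * r ^ 2) ^ n := by
  have hK : 0 ≤ K := by
    have h0 := (abs_nonneg _).trans (hw 0 0 (by norm_num) 0 (by norm_num) (by norm_num))
    simpa using h0
  have hΛ0 : 0 ≤ Λ := by
    have h0 := (abs_nonneg _).trans (hΛ 0 (by norm_num) 1 (by norm_num))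
    simpa using h0
  set e : ℝ := Real.exp (2 * B) * (4 * (K + Λ) ^ 2 * Real.exp (4 * B) + 2 * (Λ + K)) with he
  have he0 : 0 ≤ e := by positivity
  refine ⟨8 * e, by positivity, fun n k hk => ?_⟩
  set Q : ℝ := ((4 * 2 ^ n : ℕ) : ℝ) with hQ
  have hQ' : Q = 4 * 2 ^ n := by rw [hQ]; push_cast; ring
  have hQ0 : 0 < Q := by rw [hQ']; positivity
  set y : ℝ → ℝ := fun t => ∫ s in (0 : ℝ)..t, Real.exp (2 * x s) with hy
  set p : ℕ → ℝ := fun i => ((k : ℝ) + i / Q) / 2 ^ n with hp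
  set E : ℝ := Real.exp (2 * x (k / 2 ^ n)) with hE
  have hcont : ContinuousOn (fun s => Real.exp (2 * x s)) (Set.Icc 0 1) :=
    Real.continuous_exp.comp_continuousOn (hx.const_mul 2)
  have hInt : ∀ s ∈ Set.Icc (0 : ℝ) 1, ∀ t ∈ Set.Icc (0 : ℝ) 1,
      IntervalIntegrable (fun s => Real.exp (2 * x s)) volume s t := fun s hs t ht =>
    (hcont.mono (Set.uIcc_subset_Icc hs ht)).intervalIntegrable
  have hr2 : ((1 : ℝ) / 2) ^ n ≤ r ^ (2 * n) := by
    rw [pow_mul]; exact pow_le_pow_left₀ (by norm_num) hr n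
  have hrn : ((1 : ℝ) / 2) ^ n ≤ r ^ n :=
    hr2.trans (pow_le_pow_of_le_one hr0.le hr1 (by omega))
  have hstep : ∀ i, p (i + 1) - p i = 1 / (Q * 2 ^ n) := by
    intro i
    simp only [hp]
    push_cast
    field_simp
    ring
  have hk0 : ((k : ℝ) / 2 ^ n) ∈ Set.Icc (0 : ℝ) 1 :=
    div_two_pow_mem_Icc hk le_rfl (by gcongr; linarith)
  have hmem : ∀ i ≤ 4 * 2 ^ n, (k : ℝ) / 2 ^ n ≤ p i ∧ p i ≤ ((k : ℝ) + 1) / 2 ^ n := by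
    intro i hi
    have h1 : (i : ℝ) / Q ≤ 1 := (div_le_one hQ0).2 (by rw [hQ]; exact_mod_cast hi)
    have h2 : 0 ≤ (i : ℝ) / Q := by positivity
    simp only [hp]
    exact ⟨by gcongr; linarith, by gcongr⟩
  have hkey := abs_quarter_sub_sum_le (2 ^ n) (fun i => y (p i))
    (fun i => 1 / (Q * 2 ^ n) * (E + 2 * E * (w (p i) - w (k / 2 ^ n))))
    (1 / (Q * 2 ^ n) * (e * r ^ (2 * n))) ?_
  · have hy0 : y (p 0) = y ((4 * k) / 2 ^ (n + 2)) := by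
      simp only [hp]; congr 1; rw [pow_add]; push_cast; field_simp; ring
    have hy1 : y (p (2 ^ n)) = y ((4 * k + 1) / 2 ^ (n + 2)) := by
      simp only [hp]; congr 1; rw [pow_add, hQ']; push_cast; field_simp; ring
    have hy3 : y (p (3 * 2 ^ n)) = y ((4 * k + 3) / 2 ^ (n + 2)) := by
      simp only [hp]; congr 1; rw [pow_add, hQ']; push_cast; field_simp; ring
    have hy4 : y (p (4 * 2 ^ n)) = y ((4 * k + 4) / 2 ^ (n + 2)) := by
      simp only [hp]; congr 1; rw [pow_add, hQ']; push_cast; field_simp; norm_num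
    have hsum : ∑ i ∈ Finset.range (4 * 2 ^ n), quarterSign (2 ^ n) i *
        (1 / (Q * 2 ^ n) * (E + 2 * E * (w (p i) - w (k / 2 ^ n)))) =
        1 / (Q * 2 ^ n) * (2 * E * ∑ i ∈ Finset.range (4 * 2 ^ n),
          quarterSign (2 ^ n) i * w (p i)) := by
      have h1 : ∀ i, quarterSign (2 ^ n) i *
          (1 / (Q * 2 ^ n) * (E + 2 * E * (w (p i) - w (k / 2 ^ n)))) =
          quarterSign (2 ^ n) i * (1 / (Q * 2 ^ n) * (E - 2 * E * w (k / 2 ^ n))) +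
          1 / (Q * 2 ^ n) * (2 * E * (quarterSign (2 ^ n) i * w (p i))) := fun i => by ring
      simp only [h1, Finset.sum_add_distrib, ← Finset.sum_mul, ← Finset.mul_sum,
        sum_quarterSign, zero_mul, zero_add]
    simp only [hy0, hy1, hy3, hy4, hsum] at hkey
    have hpow : (2 : ℝ) ^ (n + n * H + 3) = 2 ^ n * (2 : ℝ) ^ (n * H + 3) := by
      rw [← Real.rpow_natCast, ← Real.rpow_add (by norm_num), add_assoc]
    have hpow2 : (2 : ℝ) ^ (n * H + 3) = 8 * ((2 : ℝ) ^ H) ^ n := by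
      rw [← Real.rpow_natCast, ← Real.rpow_mul (by norm_num), Real.rpow_add (by norm_num),
        mul_comm H]
      norm_num
      ring
    have hfac : (2 : ℝ) ^ (n + n * H + 3) * (1 / (Q * 2 ^ n) * (2 * E *
        ∑ i ∈ Finset.range (4 * 2 ^ n), quarterSign (2 ^ n) i * w (p i))) =
        2 * E * signedAverage H w n k := by
      rw [hpow, signedAverage]
      simp only [hp, hQ]
      field_simp
    rw [← hfac, ← mul_sub, abs_mul, abs_of_pos (by positivity)]
    refine (mul_le_mul_of_nonneg_left hkey (by positivity)).trans (le_of_eq ?_)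
    rw [hpow, hpow2, mul_pow, ← pow_mul, ← hQ]
    field_simp
  · intro i hi
    have hmi := hmem i hi.le
    have hmi' := hmem (i + 1) hi
    have hpi : p i ∈ Set.Icc (0 : ℝ) 1 := div_two_pow_mem_Icc hk hmi.1 hmi.2
    have hpi' : p (i + 1) ∈ Set.Icc (0 : ℝ) 1 := div_two_pow_mem_Icc hk hmi'.1 hmi'.2
    have hle : p i ≤ p (i + 1) := by
      rw [← sub_nonneg, hstep]; positivity
    have hyi : y (p (i + 1)) - y (p i) = ∫ s in p i..p (i + 1), Real.exp (2 * x s) :=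
      intervalIntegral.integral_interval_sub_left (hInt 0 (by norm_num) _ hpi')
        (hInt 0 (by norm_num) _ hpi)
    have hdy : p i = ((4 * 2 ^ n * k + i : ℕ) : ℝ) / 2 ^ (2 * n + 2) := by
      simp only [hp]; rw [hQ', pow_add, pow_mul']; push_cast; field_simp; ring
    have hdy' : p (i + 1) = (((4 * 2 ^ n * k + i : ℕ) : ℝ) + 1) / 2 ^ (2 * n + 2) := by
      simp only [hp]; rw [hQ', pow_add, pow_mul']; push_cast; field_simp; ring
    have hlt : 4 * 2 ^ n * k + i < 2 ^ (2 * n + 2) := by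
      have : 4 * 2 ^ n * k + 4 * 2 ^ n ≤ 4 * 2 ^ n * 2 ^ n := by
        rw [← Nat.mul_succ]; exact Nat.mul_le_mul_left _ hk
      have e2 : 4 * 2 ^ n * 2 ^ n = 2 ^ (2 * n + 2) := by ring
      omega
    change |y (p (i + 1)) - y (p i) - _| ≤ _
    rw [hyi, ← hstep i]
    refine abs_integral_sub_mul_le hle (hInt _ hpi _ hpi') fun u hu => ?_
    have hu1 : (k : ℝ) / 2 ^ n ≤ u := hmi.1.trans hu.1
    have hu2 : u ≤ ((k : ℝ) + 1) / 2 ^ n := hu.2.trans hmi'.2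
    have hum := div_two_pow_mem_Icc hk hu1 hu2
    have hL := hΛ _ hk0 u hum
    have hdist : |u - (k : ℝ) / 2 ^ n| ≤ (1 / 2) ^ n := by
      rw [abs_of_nonneg (by linarith), one_div, inv_pow, ← one_div]
      rw [add_div] at hu2
      linarith
    have hL' : |(x u - x (k / 2 ^ n)) - (w u - w (k / 2 ^ n))| ≤ Λ * (1 / 2) ^ n :=
      hL.trans (mul_le_mul_of_nonneg_left hdist hΛ0)
    have hwu := hw n k hk u hu1 hu2
    have hwi := hw (2 * n + 2) _ hlt u (by rw [← hdy]; exact hu.1) (by rw [← hdy']; exact hu.2)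
    rw [← hdy] at hwi
    have hwi' : |w u - w (p i)| ≤ K * r ^ (2 * n) := hwi.trans
      (mul_le_mul_of_nonneg_left (pow_le_pow_of_le_one hr0.le hr1 (by omega)) hK)
    have hκ : |x u - x (k / 2 ^ n)| ≤ (K + Λ) * r ^ n := by
      have h1 := abs_add_le ((x u - x (k / 2 ^ n)) - (w u - w (k / 2 ^ n))) (w u - w (k / 2 ^ n))
      rw [sub_add_cancel] at h1
      have h2 := mul_le_mul_of_nonneg_left hrn hΛ0
      linarith
    have herr : |x u - x (k / 2 ^ n) - (w (p i) - w (k / 2 ^ n))| ≤ (Λ + K) * r ^ (2 * n) := by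
      have h1 := abs_add_le ((x u - x (k / 2 ^ n)) - (w u - w (k / 2 ^ n))) (w u - w (p i))
      have h3 : (x u - x (k / 2 ^ n)) - (w u - w (k / 2 ^ n)) + (w u - w (p i)) =
        x u - x (k / 2 ^ n) - (w (p i) - w (k / 2 ^ n)) := by ring
      rw [h3] at h1
      have h2 := mul_le_mul_of_nonneg_left hr2 hΛ0
      linarith
    refine (abs_exp_sub_linear_le (hB u hum) (hB _ hk0) hκ herr).trans (le_of_eq ?_)
    rw [he, mul_pow, ← pow_mul, mul_comm n 2]
    ring

lemma sum_range_mul_eq_sum_blocks (f : ℕ → ℝ) (N L : ℕ) :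
    ∑ k ∈ Finset.range (N * L), f k =
      ∑ b ∈ Finset.range N, ∑ l ∈ Finset.range L, f (b * L + l) := by
  induction N with
  | zero => simp
  | succ N ih => rw [Nat.succ_mul, Finset.sum_range_add, ih, Finset.sum_range_succ]

lemma abs_average_le (n : ℕ) {f g : ℕ → ℝ} (h : ∀ k < 2 ^ n, |f k| ≤ g k) :
    |(1 / 2 ^ n : ℝ) * ∑ k ∈ Finset.range (2 ^ n), f k| ≤
      (1 / 2 ^ n) * ∑ k ∈ Finset.range (2 ^ n), g k := by
  rw [abs_mul, abs_of_pos (by positivity)]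
  refine mul_le_mul_of_nonneg_left ((Finset.abs_sum_le_sum_abs _ _).trans ?_) (by positivity)
  exact Finset.sum_le_sum fun k hk => h k (Finset.mem_range.1 hk)

lemma average_const (n : ℕ) (c : ℝ) :
    (1 / 2 ^ n : ℝ) * ∑ _k ∈ Finset.range (2 ^ n), c = c := by
  rw [Finset.sum_const, Finset.card_range, nsmul_eq_mul]
  push_cast
  field_simp

lemma abs_average_le_const (n : ℕ) {f : ℕ → ℝ} {c : ℝ} (h : ∀ k < 2 ^ n, |f k| ≤ c) :
    |(1 / 2 ^ n : ℝ) * ∑ k ∈ Finset.range (2 ^ n), f k| ≤ c :=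
  (abs_average_le n h).trans (average_const n c).le

/-- A weighted average of `z` with weights nearly constant on blocks. -/
lemma abs_weighted_average_sub_le {n j d : ℕ} (hn : n = j + d) {g gb z : ℕ → ℝ} {V δ M A : ℝ}
    (hz : ∀ k, 0 ≤ z k) (hδ : ∀ b < 2 ^ j, ∀ l < 2 ^ d, |g (b * 2 ^ d + l) - gb b| ≤ δ)
    (hM : ∀ b < 2 ^ j, |gb b| ≤ M) (hA : blockVar (fun k => z k - V) j d ≤ A ^ 2) (hA0 : 0 ≤ A) :
    (1 / 2 ^ n) * ∑ k ∈ Finset.range (2 ^ n), z k ≤ |V| + A ∧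
    |(1 / 2 ^ n) * ∑ k ∈ Finset.range (2 ^ n), g k * z k -
      V * ((1 / 2 ^ j) * ∑ b ∈ Finset.range (2 ^ j), gb b)| ≤ δ * (|V| + A) + M * A := by
  have hδ0 : 0 ≤ δ := (abs_nonneg _).trans (hδ 0 (by positivity) 0 (by positivity))
  have hM0 : 0 ≤ M := (abs_nonneg _).trans (hM 0 (by positivity))
  have hsum : ∀ f : ℕ → ℝ, (1 / 2 ^ n : ℝ) * ∑ k ∈ Finset.range (2 ^ n), f k =
      (1 / 2 ^ j) * ∑ b ∈ Finset.range (2 ^ j),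
        (1 / 2 ^ d) * ∑ l ∈ Finset.range (2 ^ d), f (b * 2 ^ d + l) := by
    intro f
    rw [hn, pow_add, pow_add, sum_range_mul_eq_sum_blocks, ← Finset.mul_sum]
    field_simp
  set avg : ℕ → ℝ := fun b => (1 / 2 ^ d) * ∑ l ∈ Finset.range (2 ^ d), (z (b * 2 ^ d + l) - V)
    with havg
  have hzavg : ∀ b, (1 / 2 ^ d) * ∑ l ∈ Finset.range (2 ^ d), z (b * 2 ^ d + l) = avg b + V := by
    intro b
    simp only [havg, Finset.sum_sub_distrib, mul_sub, average_const]
    ring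
  have habs : (1 / 2 ^ j) * ∑ b ∈ Finset.range (2 ^ j), |avg b| ≤ A := by
    refine abs_le_of_sq_le_sq' ?_ hA0 |>.2
    refine le_trans ?_ hA
    have h := sq_sum_le_card_mul_sum_sq (s := Finset.range (2 ^ j)) (f := fun b => |avg b|)
    simp only [sq_abs, Finset.card_range] at h
    push_cast at h
    unfold blockVar
    rw [mul_pow]
    refine (mul_le_mul_of_nonneg_left h (by positivity)).trans (le_of_eq ?_)
    simp only [havg]
    field_simp
  have hS : (1 / 2 ^ n) * ∑ k ∈ Finset.range (2 ^ n), z k ≤ |V| + A := by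
    rw [hsum]
    simp only [hzavg, Finset.sum_add_distrib, mul_add, average_const]
    have h1 := abs_average_le j (f := avg) (g := fun b => |avg b|) fun _ _ => le_rfl
    linarith [le_abs_self V, (abs_le.1 h1).2]
  refine ⟨hS, ?_⟩
  have e1 : (1 / 2 ^ n) * ∑ k ∈ Finset.range (2 ^ n), g k * z k -
      V * ((1 / 2 ^ j) * ∑ b ∈ Finset.range (2 ^ j), gb b) =
      (1 / 2 ^ j) * ∑ b ∈ Finset.range (2 ^ j), ((1 / 2 ^ d) * ∑ l ∈ Finset.range (2 ^ d),
        (g (b * 2 ^ d + l) - gb b) * z (b * 2 ^ d + l)) +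
      (1 / 2 ^ j) * ∑ b ∈ Finset.range (2 ^ j), gb b * avg b := by
    have e2 : ∀ b, gb b * avg b = (1 / 2 ^ d) * (∑ l ∈ Finset.range (2 ^ d),
        gb b * z (b * 2 ^ d + l)) - V * gb b := by
      intro b
      rw [← Finset.mul_sum, ← sub_eq_iff_eq_add.2 (hzavg b)]
      ring
    simp only [hsum (fun k => g k * z k), e2, sub_mul, Finset.sum_sub_distrib, mul_sub,
      ← Finset.mul_sum]
    ring
  rw [e1]
  refine (abs_add_le _ _).trans (add_le_add ?_ ?_)
  · refine (abs_average_le j (g := fun b => (1 / 2 ^ d) * ∑ l ∈ Finset.range (2 ^ d),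
      δ * z (b * 2 ^ d + l)) fun b hb => abs_average_le d fun l hl => ?_).trans ?_
    · rw [abs_mul, abs_of_nonneg (hz _)]
      exact mul_le_mul_of_nonneg_right (hδ b hb l hl) (hz _)
    · rw [← hsum (fun k => δ * z k), ← Finset.mul_sum, mul_left_comm]
      exact mul_le_mul_of_nonneg_left hS hδ0
  · refine (abs_average_le j (g := fun b => M * |avg b|) fun b hb => ?_).trans ?_
    · rw [abs_mul]
      exact mul_le_mul_of_nonneg_right (hM b hb) (abs_nonneg _)
    · rw [← Finset.mul_sum, mul_left_comm]
      exact mul_le_mul_of_nonneg_left habs hM0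

/-- Averages of squares are stable under perturbation. -/
lemma abs_average_sq_sub_le (n : ℕ) {D u : ℕ → ℝ} {e : ℝ} (h : ∀ k < 2 ^ n, |D k - u k| ≤ e) :
    |(1 / 2 ^ n) * ∑ k ∈ Finset.range (2 ^ n), D k ^ 2 -
      (1 / 2 ^ n) * ∑ k ∈ Finset.range (2 ^ n), u k ^ 2| ≤
      e * (e + 1 + (1 / 2 ^ n) * ∑ k ∈ Finset.range (2 ^ n), u k ^ 2) := by
  have he : 0 ≤ e := (abs_nonneg _).trans (h 0 (by positivity))
  rw [← mul_sub, ← Finset.sum_sub_distrib]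
  refine (abs_average_le n (g := fun k => e * (e + 1 + u k ^ 2)) fun k hk => ?_).trans
    (le_of_eq ?_)
  · have e1 : D k ^ 2 - u k ^ 2 = (D k - u k) * ((D k - u k) + 2 * u k) := by ring
    rw [e1, abs_mul]
    refine mul_le_mul (h k hk) ((abs_add_le _ _).trans ?_) (abs_nonneg _) he
    have h1 : |2 * u k| ≤ 1 + u k ^ 2 := by
      rw [abs_le]; constructor <;> nlinarith [sq_nonneg (u k + 1), sq_nonneg (u k - 1)]
    linarith [h k hk]
  · rw [← Finset.mul_sum, mul_left_comm, Finset.sum_add_distrib, mul_add, average_const]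

/-- Riemann sums over dyadic partitions. -/
lemma abs_average_sub_integral_le {f : ℝ → ℝ} (hf : ContinuousOn f (Set.Icc 0 1)) (j : ℕ) {δ : ℝ}
    (h : ∀ b : ℕ, b < 2 ^ j → ∀ t : ℝ, (b : ℝ) / 2 ^ j ≤ t → t ≤ ((b : ℝ) + 1) / 2 ^ j →
      |f t - f ((b : ℝ) / 2 ^ j)| ≤ δ) :
    |(1 / 2 ^ j) * ∑ b ∈ Finset.range (2 ^ j), f ((b : ℝ) / 2 ^ j) -
      ∫ t in (0 : ℝ)..1, f t| ≤ δ := by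
  set p : ℕ → ℝ := fun b => (b : ℝ) / 2 ^ j with hp
  have hmem : ∀ b ≤ 2 ^ j, p b ∈ Set.Icc (0 : ℝ) 1 := fun b hb =>
    ⟨by positivity, (div_le_one (by positivity)).2 (by exact_mod_cast hb)⟩
  have hInt : ∀ b < 2 ^ j, IntervalIntegrable f volume (p b) (p (b + 1)) := fun b hb =>
    (hf.mono (Set.uIcc_subset_Icc (hmem b hb.le) (hmem (b + 1) hb))).intervalIntegrable
  have hs := intervalIntegral.sum_integral_adjacent_intervals (f := f) (μ := volume) (a := p)
    (n := 2 ^ j) fun b hb => hInt b hb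
  have h0 : p 0 = 0 := by simp [hp]
  have h1 : p (2 ^ j) = 1 := by simp [hp]
  have hp1 : ∀ b, p (b + 1) = ((b : ℝ) + 1) / 2 ^ j := fun b => by simp [hp]
  rw [h0, h1] at hs
  have e1 : (∫ t in (0 : ℝ)..1, f t) = (1 / 2 ^ j) * ∑ b ∈ Finset.range (2 ^ j),
      2 ^ j * ∫ t in p b..p (b + 1), f t := by
    rw [← Finset.mul_sum, hs]
    field_simp
  rw [e1, ← mul_sub, ← Finset.sum_sub_distrib]
  refine abs_average_le_const j fun b hb => ?_
  have hst : p (b + 1) - p b = 1 / 2 ^ j := by rw [hp1]; simp only [hp]; ring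
  have h2 := abs_integral_sub_mul_le (c := f (p b)) (e := δ)
    (by rw [← sub_nonneg, hst]; positivity) (hInt b hb) fun u hu => by
      refine h b hb u hu.1 ?_
      rw [← hp1]; exact hu.2
  rw [hst] at h2
  have e2 : f (p b) - 2 ^ j * ∫ t in p b..p (b + 1), f t =
      -(2 ^ j * ((∫ t in p b..p (b + 1), f t) - 1 / 2 ^ j * f (p b))) := by
    field_simp
    ring
  rw [e2, abs_neg, abs_mul, abs_of_pos (by positivity)]
  refine (mul_le_mul_of_nonneg_left h2 (by positivity)).trans (le_of_eq ?_)
  field_simp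

lemma abs_exp_sub_exp_le {a b M : ℝ} (ha : a ≤ M) (hb : b ≤ M) :
    |Real.exp a - Real.exp b| ≤ Real.exp M * |a - b| := by
  have key : ∀ a b : ℝ, a ≤ M → Real.exp a - Real.exp b ≤ Real.exp M * |a - b| := by
    intro a b ha
    have h1 : Real.exp a - Real.exp b = Real.exp a * (1 - Real.exp (b - a)) := by
      rw [mul_sub, ← Real.exp_add]; simp
    have h2 := Real.add_one_le_exp (b - a)
    rw [h1]
    refine (mul_le_mul_of_nonneg_left (?_ : _ ≤ |a - b|) (Real.exp_pos _).le).trans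
      (mul_le_mul_of_nonneg_right (Real.exp_le_exp.2 ha) (abs_nonneg _))
    linarith [le_abs_self (a - b)]
  rw [abs_le]
  refine ⟨?_, key a b ha⟩
  have := key b a hb
  rw [abs_sub_comm] at this
  linarith

lemma exists_average_sq_sub_le {ξ D u : ℕ → ℕ → ℝ} {g : ℝ → ℝ} {V : ℕ → ℝ} {j : ℕ → ℕ}
    {v ε r Kg M Cj CV Kb CD : ℝ} (hε0 : 0 < ε) (hε1 : ε ≤ 1)
    (hg : ContinuousOn g (Set.Icc 0 1)) (hM : ∀ t ∈ Set.Icc (0 : ℝ) 1, |g t| ≤ M)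
    (hgr : ∀ n k : ℕ, k < 2 ^ n → ∀ t : ℝ, (k : ℝ) / 2 ^ n ≤ t → t ≤ ((k : ℝ) + 1) / 2 ^ n →
      |g t - g ((k : ℝ) / 2 ^ n)| ≤ Kg * r ^ n)
    (hj : ∀ n, j n ≤ n) (hrj : ∀ n, r ^ j n ≤ Cj * ε ^ n) (hV : ∀ n, |V n - v| ≤ CV * ε ^ n)
    (hb : ∀ n, blockVar (fun k => ξ n k ^ 2 - V n) (j n) (n - j n) ≤ Kb * (ε ^ n) ^ 2)
    (hu : ∀ n k : ℕ, u n k ^ 2 = g (k / 2 ^ n) * ξ n k ^ 2)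
    (hD : ∀ n k : ℕ, k < 2 ^ n → |D n k - u n k| ≤ CD * ε ^ n) :
    ∃ C : ℝ, ∀ n, |(1 / 2 ^ n) * ∑ k ∈ Finset.range (2 ^ n), D n k ^ 2 -
      v * ∫ t in (0 : ℝ)..1, g t| ≤ C * ε ^ n := by
  have hM0 : 0 ≤ M := (abs_nonneg _).trans (hM 0 (by norm_num))
  have hCV : 0 ≤ CV := by simpa using (abs_nonneg _).trans (hV 0)
  have hCD : 0 ≤ CD := by simpa using (abs_nonneg _).trans (hD 0 0 (by norm_num))
  have hKg : 0 ≤ Kg := by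
    simpa using (abs_nonneg _).trans (hgr 0 0 (by norm_num) 0 (by norm_num) (by norm_num))
  set K₀ : ℝ := Real.sqrt (max Kb 0) with hK₀
  have hK₀0 : 0 ≤ K₀ := Real.sqrt_nonneg _
  set S : ℝ := |v| + CV + K₀ with hS
  have hS0 : 0 ≤ S := by positivity
  refine ⟨CD * (CD + 1 + M * S) + (Kg * Cj * S + M * K₀) + (CV * M + |v| * (Kg * Cj)),
    fun n => ?_⟩
  have hεn0 : 0 < ε ^ n := by positivity
  have hεn1 : ε ^ n ≤ 1 := pow_le_one₀ hε0.le hε1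
  have hδ : ∀ b : ℕ, b < 2 ^ j n → ∀ t : ℝ, (b : ℝ) / 2 ^ j n ≤ t → t ≤ ((b : ℝ) + 1) / 2 ^ j n →
      |g t - g ((b : ℝ) / 2 ^ j n)| ≤ Kg * Cj * ε ^ n := fun b hbj t h0 h1 => by
    rw [mul_assoc]
    exact (hgr _ b hbj t h0 h1).trans (mul_le_mul_of_nonneg_left (hrj n) hKg)
  have hδ0 : 0 ≤ Kg * Cj * ε ^ n := (abs_nonneg _).trans
    (hδ 0 (by positivity) 0 (by simp) (by positivity))
  have hgb : ∀ b : ℕ, b < 2 ^ j n → |g ((b : ℝ) / 2 ^ j n)| ≤ M := fun b hbj =>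
    hM _ (div_two_pow_mem_Icc hbj le_rfl (by gcongr; linarith))
  have hVn : |V n| ≤ |v| + CV := by
    have h1 := abs_add_le (V n - v) v
    rw [sub_add_cancel] at h1
    have h2 := mul_le_mul_of_nonneg_left hεn1 hCV
    linarith [hV n]
  have hblock := abs_weighted_average_sub_le (n := n) (j := j n) (d := n - j n)
    (g := fun k => g ((k : ℝ) / 2 ^ n)) (gb := fun b => g ((b : ℝ) / 2 ^ j n))
    (z := fun k => ξ n k ^ 2) (V := V n) (δ := Kg * Cj * ε ^ n) (M := M) (A := K₀ * ε ^ n)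
    (by have := hj n; omega) (fun k => sq_nonneg (ξ n k)) ?_ hgb ?_ (by positivity)
  · obtain ⟨hz, hzg⟩ := hblock
    have hA1 : K₀ * ε ^ n ≤ K₀ := mul_le_of_le_one_right hK₀0 hεn1
    have hVA : |V n| + K₀ * ε ^ n ≤ S := by rw [hS]; linarith
    have hu2 : (1 / 2 ^ n) * ∑ k ∈ Finset.range (2 ^ n), u n k ^ 2 ≤ M * S := by
      refine le_trans ?_ (mul_le_mul_of_nonneg_left (hz.trans hVA) hM0)
      rw [mul_left_comm, Finset.mul_sum _ _ M]
      have h2n : (0 : ℝ) ≤ 1 / 2 ^ n := by positivity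
      refine mul_le_mul_of_nonneg_left (Finset.sum_le_sum fun k hk => ?_) h2n
      rw [hu]
      refine mul_le_mul_of_nonneg_right ((le_abs_self _).trans (hM _ ?_)) (sq_nonneg _)
      exact div_two_pow_mem_Icc (Finset.mem_range.1 hk) le_rfl (by gcongr; linarith)
    have h1 := abs_average_sq_sub_le n (D := D n) (u := u n) (hD n)
    have h1' : CD * ε ^ n * (CD * ε ^ n + 1 +
        (1 / 2 ^ n) * ∑ k ∈ Finset.range (2 ^ n), u n k ^ 2) ≤
        CD * ε ^ n * (CD + 1 + M * S) := by
      refine mul_le_mul_of_nonneg_left ?_ (by positivity)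
      have := mul_le_of_le_one_right hCD hεn1
      linarith
    simp only [hu n] at h1 h1'
    have h2 : Kg * Cj * ε ^ n * (|V n| + K₀ * ε ^ n) + M * (K₀ * ε ^ n) ≤
        Kg * Cj * ε ^ n * S + M * (K₀ * ε ^ n) := by
      have := mul_le_mul_of_nonneg_left hVA hδ0
      linarith
    have h3 := abs_average_sub_integral_le hg (j n) hδ
    set a : ℝ := (1 / 2 ^ j n) * ∑ b ∈ Finset.range (2 ^ j n), g ((b : ℝ) / 2 ^ j n) with ha
    set I : ℝ := ∫ t in (0 : ℝ)..1, g t with hI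
    have ha' : |a| ≤ M := abs_average_le_const (j n) hgb
    have h4 : |V n * a - v * I| ≤ CV * ε ^ n * M + |v| * (Kg * Cj * ε ^ n) := by
      have e : V n * a - v * I = (V n - v) * a + v * (a - I) := by ring
      rw [e]
      refine (abs_add_le _ _).trans (add_le_add ?_ ?_)
      · rw [abs_mul]
        exact mul_le_mul (hV n) ha' (abs_nonneg _) (by positivity)
      · rw [abs_mul]
        exact mul_le_mul_of_nonneg_left h3 (abs_nonneg _)
    have e := abs_sub_le ((1 / 2 ^ n) * ∑ k ∈ Finset.range (2 ^ n), D n k ^ 2)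
      ((1 / 2 ^ n) * ∑ k ∈ Finset.range (2 ^ n), g ((k : ℝ) / 2 ^ n) * ξ n k ^ 2) (v * I)
    have e' := abs_sub_le
      ((1 / 2 ^ n) * ∑ k ∈ Finset.range (2 ^ n), g ((k : ℝ) / 2 ^ n) * ξ n k ^ 2) (V n * a) (v * I)
    nlinarith
  · intro b hbj l hl
    have e : (2 : ℝ) ^ n = 2 ^ j n * 2 ^ (n - j n) := by
      rw [← pow_add, Nat.add_sub_cancel' (hj n)]
    have e2 : ((b * 2 ^ (n - j n) + l : ℕ) : ℝ) / 2 ^ n =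
        ((b : ℝ) + l / 2 ^ (n - j n)) / 2 ^ j n := by
      rw [e]; push_cast; field_simp
    have h1 : (l : ℝ) / 2 ^ (n - j n) ≤ 1 :=
      (div_le_one (by positivity)).2 (by exact_mod_cast hl.le)
    have h0 : 0 ≤ (l : ℝ) / 2 ^ (n - j n) := by positivity
    change |g (((b * 2 ^ (n - j n) + l : ℕ) : ℝ) / 2 ^ n) - g ((b : ℝ) / 2 ^ j n)| ≤ _
    rw [e2]
    refine hδ b hbj _ ?_ ?_
    · gcongr; linarith
    · gcongr
  · refine (hb n).trans ?_
    rw [mul_pow, hK₀, Real.sq_sqrt (le_max_right _ _)]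
    exact mul_le_mul_of_nonneg_right (le_max_left _ _) (by positivity)

lemma abs_log_sub_log_le {x y z : ℝ} (hz : 0 < z) (hx : z ≤ x) (hy : z ≤ y) :
    |Real.log x - Real.log y| ≤ |x - y| / z := by
  have key : ∀ x y : ℝ, z ≤ x → z ≤ y → Real.log x - Real.log y ≤ |x - y| / z := by
    intro x y hx hy
    have hy0 : 0 < y := hz.trans_le hy
    have hx0 : 0 < x := hz.trans_le hx
    rw [← Real.log_div hx0.ne' hy0.ne']
    have h1 := Real.log_le_sub_one_of_pos (div_pos hx0 hy0)
    have h2 : x / y - 1 = (x - y) / y := by field_simp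
    have h3 : (x - y) / y ≤ |x - y| / z :=
      (div_le_div_of_nonneg_right (le_abs_self _) hy0.le).trans
        (div_le_div_of_nonneg_left (abs_nonneg _) hz hy)
    linarith
  rw [abs_le]
  refine ⟨?_, key x y hx hy⟩
  have := key y x hy hx
  rw [abs_sub_comm] at this
  linarith

lemma Rhat_const_mul {n : ℕ} {f : ℝ → ℝ} {η : ℝ} (hη : 0 < η)
    (hs : 0 < ∑ k ∈ Finset.range (2 ^ n), vartheta f n k ^ 2) :
    Rhat n (fun t => η * f t) = 1 - (1 / (n : ℝ)) * (Real.logb 2 η +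
      Real.logb 2 (∑ k ∈ Finset.range (2 ^ n), vartheta f n k ^ 2) / 2) := by
  have h1 : ∀ k, vartheta (fun t => η * f t) n k = η * vartheta f n k := fun k => by
    unfold vartheta; ring
  have hr : 0 < Real.sqrt (∑ k ∈ Finset.range (2 ^ n), vartheta f n k ^ 2) := Real.sqrt_pos.2 hs
  unfold Rhat
  simp only [h1, mul_pow, ← Finset.mul_sum]
  rw [Real.sqrt_mul (sq_nonneg _), Real.sqrt_sq hη.le, Real.logb_mul hη.ne' hr.ne']
  congr 3
  rw [Real.logb, Real.log_sqrt hs.le, Real.logb]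
  ring

/-- Asymptotics of the estimator from asymptotics of the rescaled energy. -/
lemma exists_Rhat_const_mul_eq {f : ℝ → ℝ} {H σ C ε : ℝ} (hσ : 0 < σ) (hε0 : 0 < ε) (hε1 : ε < 1)
    (h : ∀ n : ℕ, |(1 / 2 ^ n) * ∑ k ∈ Finset.range (2 ^ n),
      ((2 : ℝ) ^ (n * (H - 1 / 2)) * vartheta f n k) ^ 2 - σ| ≤ C * ε ^ n) :
    ∃ (c C' : ℝ) (δ : ℕ → ℝ) (N : ℕ), 0 ≤ C' ∧ ∀ n, N ≤ n → 0 < n → |δ n| ≤ C' * ε ^ n ∧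
      ∀ η : ℝ, 0 < η → Rhat n (fun t => η * f t) = H - (c + δ n + Real.logb 2 η) / n := by
  set U : ℕ → ℝ := fun n => (1 / 2 ^ n) * ∑ k ∈ Finset.range (2 ^ n),
    ((2 : ℝ) ^ (n * (H - 1 / 2)) * vartheta f n k) ^ 2 with hU
  have hC : 0 ≤ C := by simpa using (abs_nonneg _).trans (h 0)
  have hlim : Tendsto (fun n : ℕ => C * ε ^ n) atTop (nhds 0) := by
    simpa using (tendsto_pow_atTop_nhds_zero_of_lt_one hε0.le hε1).const_mul C
  obtain ⟨N, hN⟩ := eventually_atTop.1 (hlim.eventually (ge_mem_nhds (half_pos hσ)))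
  have hl2 : 0 < Real.log 2 := Real.log_pos (by norm_num)
  refine ⟨Real.logb 2 σ / 2, C / (σ / 2) / Real.log 2 / 2,
    fun n => (Real.logb 2 (U n) - Real.logb 2 σ) / 2, N, by positivity, fun n hn hn0 => ?_⟩
  have h2 : σ / 2 ≤ U n := by
    have := (abs_le.1 ((h n).trans (hN n hn))).1
    linarith
  have hU0 : 0 < U n := (half_pos hσ).trans_le h2
  refine ⟨?_, fun η hη => ?_⟩
  · have h3 := abs_log_sub_log_le (half_pos hσ) h2 (by linarith : σ / 2 ≤ σ)
    simp only [Real.logb]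
    rw [← sub_div, abs_div, abs_div, abs_of_pos hl2, abs_two]
    have h4 : |U n - σ| / (σ / 2) ≤ C * ε ^ n / (σ / 2) :=
      div_le_div_of_nonneg_right (h n) (half_pos hσ).le
    have h5 : |Real.log (U n) - Real.log σ| / Real.log 2 / 2 ≤
        C * ε ^ n / (σ / 2) / Real.log 2 / 2 := by gcongr; exact h3.trans h4
    refine h5.trans (le_of_eq ?_)
    ring
  · have hs : ∑ k ∈ Finset.range (2 ^ n), vartheta f n k ^ 2 =
        (2 : ℝ) ^ (2 * (n * (1 - H))) * U n := by
      simp only [hU, mul_pow, ← Finset.mul_sum]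
      have e1 : ((2 : ℝ) ^ (n * (H - 1 / 2))) ^ 2 * (2 : ℝ) ^ (2 * (n * (1 - H))) = 2 ^ n := by
        rw [← Real.rpow_natCast, ← Real.rpow_mul (by norm_num), ← Real.rpow_add (by norm_num),
          ← Real.rpow_natCast]
        congr 1
        push_cast
        ring
      have e2 : (2 : ℝ) ^ n ≠ 0 := by positivity
      generalize ∑ k ∈ Finset.range (2 ^ n), vartheta f n k ^ 2 = S
      generalize ((2 : ℝ) ^ (n * (H - 1 / 2))) ^ 2 = b at e1 ⊢
      generalize (2 : ℝ) ^ (2 * (n * (1 - H))) = d at e1 ⊢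
      rw [show d * (1 / 2 ^ n * (b * S)) = b * d / 2 ^ n * S by ring, e1, div_self e2, one_mul]
    have hs0 : 0 < ∑ k ∈ Finset.range (2 ^ n), vartheta f n k ^ 2 := by rw [hs]; positivity
    rw [Rhat_const_mul hη hs0, hs, Real.logb_mul (by positivity) hU0.ne',
      Real.logb_rpow (by norm_num) (by norm_num)]
    have hn' : (n : ℝ) ≠ 0 := by exact_mod_cast hn0.ne'
    field_simp
    ring

/-- The sequential scaling argument. -/
lemma exists_abs_sequential_sub_le {F : ℕ → ℝ → ℝ} {H c C ε : ℝ} {δ : ℕ → ℝ} {N m : ℕ}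
    {a : ℕ → ℝ} {ηs : ℕ → ℝ} (hC : 0 ≤ C) (hε0 : 0 < ε) (hε1 : ε < 1) (ha0 : 0 < a 0)
    (ha : ∀ j ≤ m, 0 ≤ a j)
    (hF : ∀ n, N ≤ n → 0 < n → |δ n| ≤ C * ε ^ n ∧
      ∀ η : ℝ, 0 < η → F n η = H - (c + δ n + Real.logb 2 η) / n)
    (hη : ∀ n, m < n → 0 < ηs n ∧ ∀ η : ℝ, 0 < η →
      ∑ k ∈ Finset.Icc (n - m) n, a (n - k) * (F k (ηs n) - F (k - 1) (ηs n)) ^ 2 ≤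
      ∑ k ∈ Finset.Icc (n - m) n, a (n - k) * (F k η - F (k - 1) η) ^ 2) :
    ∃ C' : ℝ, ∀ᶠ n : ℕ in atTop, |F n (ηs n) - H| ≤ C' * ε ^ n := by
  set A : ℝ := ∑ j ∈ Finset.range (m + 1), a j with hA
  have haA : ∀ j ≤ m, a j ≤ A := fun j hj =>
    Finset.single_le_sum (f := a) (fun i hi => ha i (by rw [Finset.mem_range] at hi; omega))
      (Finset.mem_range.2 (by omega))
  have hA0 : 0 ≤ A := ha0.le.trans (haA 0 (Nat.zero_le _))
  set C₁ : ℝ := 4 * C * (1 / ε) ^ (m + 1) with hC₁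
  have hC₁0 : 0 ≤ C₁ := by positivity
  set C₂ : ℝ := Real.sqrt ((m + 1) * A / a 0) * C₁ with hC₂
  have hC₂0 : 0 ≤ C₂ := by positivity
  refine ⟨C₁ + C₂ + C, eventually_atTop.2 ⟨N + 2 * m + 2, fun n hn => ?_⟩⟩
  have hn0 : (0 : ℝ) < n := by
    have : 0 < n := by omega
    exact_mod_cast this
  have hεn : 0 < ε ^ n := by positivity
  have hbd : ∀ k, n - m - 1 ≤ k → |δ k / k| ≤ C₁ / 2 * ε ^ n / n := by
    intro k hk
    have hk0 : (0 : ℝ) < k := by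
      have : 0 < k := by omega
      exact_mod_cast this
    have h1 := (hF k (by omega) (by omega)).1
    have h2 : (n : ℝ) / 2 ≤ k := by
      have : n ≤ 2 * k := by omega
      have : (n : ℝ) ≤ 2 * k := by exact_mod_cast this
      linarith
    have h3 : ε ^ k ≤ (1 / ε) ^ (m + 1) * ε ^ n := by
      have e : ε ^ n = ε ^ (n - m - 1) * ε ^ (m + 1) := by
        rw [← pow_add]; congr 1; omega
      rw [e, one_div, inv_pow, mul_comm (ε ^ (n - m - 1)), ← mul_assoc,
        inv_mul_cancel₀ (by positivity), one_mul]
      exact pow_le_pow_of_le_one hε0.le hε1.le hk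
    rw [abs_div, abs_of_pos hk0]
    have h4 : |δ k| ≤ C * ((1 / ε) ^ (m + 1) * ε ^ n) :=
      h1.trans (mul_le_mul_of_nonneg_left h3 hC)
    refine (div_le_div₀ (by positivity) h4 (by positivity) h2).trans (le_of_eq ?_)
    rw [hC₁]
    field_simp
    ring
  have hdiff : ∀ k, n - m ≤ k → |δ (k - 1) / ((k - 1 : ℕ) : ℝ) - δ k / k| ≤ C₁ * ε ^ n / n := by
    intro k hk
    have h1 := hbd k (by omega)
    have h2 := hbd (k - 1) (by omega)
    refine (abs_sub _ _).trans ?_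
    have : C₁ * ε ^ n / n = C₁ / 2 * ε ^ n / n + C₁ / 2 * ε ^ n / n := by ring
    linarith
  obtain ⟨hpos, hmin⟩ := hη n (by omega)
  have hc := hmin ((2 : ℝ) ^ (-c)) (by positivity)
  have hlc : Real.logb 2 ((2 : ℝ) ^ (-c)) = -c := Real.logb_rpow (by norm_num) (by norm_num)
  have hR : ∑ k ∈ Finset.Icc (n - m) n, a (n - k) *
      (F k ((2 : ℝ) ^ (-c)) - F (k - 1) ((2 : ℝ) ^ (-c))) ^ 2 ≤
      (m + 1) * A * (C₁ * ε ^ n / n) ^ 2 := by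
    have hterm : ∀ k ∈ Finset.Icc (n - m) n, a (n - k) *
        (F k ((2 : ℝ) ^ (-c)) - F (k - 1) ((2 : ℝ) ^ (-c))) ^ 2 ≤ A * (C₁ * ε ^ n / n) ^ 2 := by
      intro k hk
      rw [Finset.mem_Icc] at hk
      refine mul_le_mul (haA _ (by omega)) ?_ (sq_nonneg _) hA0
      rw [(hF k (by omega) (by omega)).2 _ (by positivity),
        (hF (k - 1) (by omega) (by omega)).2 _ (by positivity), hlc]
      have e : H - (c + δ k + -c) / k - (H - (c + δ (k - 1) + -c) / ((k - 1 : ℕ) : ℝ)) =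
          δ (k - 1) / ((k - 1 : ℕ) : ℝ) - δ k / k := by ring
      rw [e, ← sq_abs]
      exact pow_le_pow_left₀ (abs_nonneg _) (hdiff k hk.1) 2
    refine (Finset.sum_le_sum hterm).trans (le_of_eq ?_)
    rw [Finset.sum_const, Nat.card_Icc, nsmul_eq_mul]
    have : n + 1 - (n - m) = m + 1 := by omega
    rw [this]
    push_cast
    ring
  have hL : a 0 * (F n (ηs n) - F (n - 1) (ηs n)) ^ 2 ≤
      ∑ k ∈ Finset.Icc (n - m) n, a (n - k) * (F k (ηs n) - F (k - 1) (ηs n)) ^ 2 := by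
    have h1 := Finset.single_le_sum (s := Finset.Icc (n - m) n)
      (f := fun k => a (n - k) * (F k (ηs n) - F (k - 1) (ηs n)) ^ 2)
      (fun k hk => mul_nonneg (ha _ (by rw [Finset.mem_Icc] at hk; omega)) (sq_nonneg _))
      (Finset.mem_Icc.2 ⟨Nat.sub_le _ _, le_rfl⟩)
    simpa using h1
  have hD : |F n (ηs n) - F (n - 1) (ηs n)| ≤ C₂ * ε ^ n / n := by
    refine abs_le_of_sq_le_sq ?_ (by positivity)
    have h1 : a 0 * (F n (ηs n) - F (n - 1) (ηs n)) ^ 2 ≤ (m + 1) * A * (C₁ * ε ^ n / n) ^ 2 :=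
      hL.trans (hc.trans hR)
    have h2 : (C₂ * ε ^ n / n) ^ 2 = ((m + 1) * A * (C₁ * ε ^ n / n) ^ 2) / a 0 := by
      have h3 : Real.sqrt ((m + 1) * A / a 0) ^ 2 = (m + 1) * A / a 0 :=
        Real.sq_sqrt (by positivity)
      rw [hC₂, div_pow, mul_pow, mul_pow, h3]
      ring
    rw [h2, le_div_iff₀ ha0]
    linarith
  have hn1 : (0 : ℝ) < ((n - 1 : ℕ) : ℝ) := by
    have : 0 < n - 1 := by omega
    exact_mod_cast this
  have hFn := (hF n (by omega) (by omega)).2 _ hpos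
  have hFn1 := (hF (n - 1) (by omega) (by omega)).2 _ hpos
  set κ : ℝ := c + Real.logb 2 (ηs n) with hκ
  have hcast : ((n - 1 : ℕ) : ℝ) = n - 1 := by
    rw [Nat.cast_sub (by omega)]; simp
  have hκe : κ / (n * ((n - 1 : ℕ) : ℝ)) = (F n (ηs n) - F (n - 1) (ηs n)) -
      (δ (n - 1) / ((n - 1 : ℕ) : ℝ) - δ n / n) := by
    rw [hFn, hFn1, hκ]
    field_simp
    rw [hcast]
    ring
  have hκ1 : |κ / (n * ((n - 1 : ℕ) : ℝ))| ≤ (C₁ + C₂) * ε ^ n / n := by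
    rw [hκe]
    refine (abs_sub _ _).trans ?_
    have := hdiff n (Nat.sub_le _ _)
    have e : (C₁ + C₂) * ε ^ n / n = C₂ * ε ^ n / n + C₁ * ε ^ n / n := by ring
    linarith
  have hκ2 : |κ / n| ≤ (C₁ + C₂) * ε ^ n := by
    have e : κ / n = κ / (n * ((n - 1 : ℕ) : ℝ)) * ((n - 1 : ℕ) : ℝ) := by field_simp
    rw [e, abs_mul, abs_of_pos hn1]
    refine (mul_le_mul hκ1 (by rw [hcast]; linarith : ((n - 1 : ℕ) : ℝ) ≤ n) hn1.le
      (by positivity)).trans (le_of_eq ?_)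
    field_simp
  have hδn : |δ n / n| ≤ C * ε ^ n := by
    rw [abs_div, abs_of_pos hn0]
    refine (div_le_self (abs_nonneg _) ?_).trans (hF n (by omega) (by omega)).1
    have : 1 ≤ n := by omega
    exact_mod_cast this
  have e : F n (ηs n) - H = -(κ / n) + -(δ n / n) := by rw [hFn, hκ]; ring
  rw [e]
  refine (abs_add_le _ _).trans ?_
  rw [abs_neg, abs_neg]
  linarith

/-- Pathwise convergence of the rescaled energy of the integrated variance, with rate. -/
lemma exists_energy_sub_le {w x : ℝ → ℝ} {H K r Λ B ε v CV Cj Kb : ℝ} {V : ℕ → ℝ} {j : ℕ → ℕ}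
    (hε0 : 0 < ε) (hε1 : ε ≤ 1) (hr : 1 / 2 ≤ r ^ 2) (hr0 : 0 < r) (hr1 : r ≤ 1)
    (hrε : (2 : ℝ) ^ H * r ^ 2 ≤ ε)
    (hx : ContinuousOn x (Set.Icc 0 1)) (hB : ∀ t ∈ Set.Icc (0 : ℝ) 1, |x t| ≤ B)
    (hw : ∀ n k : ℕ, k < 2 ^ n → ∀ t : ℝ, (k : ℝ) / 2 ^ n ≤ t → t ≤ ((k : ℝ) + 1) / 2 ^ n →
      |w t - w ((k : ℝ) / 2 ^ n)| ≤ K * r ^ n)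
    (hΛ : ∀ s ∈ Set.Icc (0 : ℝ) 1, ∀ t ∈ Set.Icc (0 : ℝ) 1,
      |(x t - x s) - (w t - w s)| ≤ Λ * |t - s|)
    (hj : ∀ n, j n ≤ n) (hrj : ∀ n, r ^ j n ≤ Cj * ε ^ n) (hV : ∀ n, |V n - v| ≤ CV * ε ^ n)
    (hb : ∀ n, blockVar (fun k => signedAverage H w n k ^ 2 - V n) (j n) (n - j n) ≤
      Kb * (ε ^ n) ^ 2) :
    ∃ C : ℝ, ∀ n : ℕ, |(1 / 2 ^ n) * ∑ k ∈ Finset.range (2 ^ n), ((2 : ℝ) ^ (n * (H - 1 / 2)) *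
      vartheta (fun t => ∫ s in (0 : ℝ)..t, Real.exp (2 * x s)) n k) ^ 2 -
        v * ∫ t in (0 : ℝ)..1, 4 * Real.exp (4 * x t)| ≤ C * ε ^ n := by
  obtain ⟨C, hC0, hC⟩ := exists_quarter_difference_sub_le H hr hr0 hr1 hx hB hw hΛ
  have hΛ0 : 0 ≤ Λ := by
    simpa using (abs_nonneg _).trans (hΛ 0 (by norm_num) 1 (by norm_num))
  have hr2 : 1 / 2 ≤ r := hr.trans (by nlinarith)
  refine exists_average_sq_sub_le (ξ := signedAverage H w)
    (u := fun n k => 2 * Real.exp (2 * x (k / 2 ^ n)) * signedAverage H w n k)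
    (V := V) (j := j) (r := r) (Kg := 4 * (Real.exp (4 * B) * (4 * (K + Λ))))
    (M := 4 * Real.exp (4 * B)) (Cj := Cj) (CV := CV) (Kb := Kb) (CD := C)
    hε0 hε1 ?_ ?_ ?_ hj hrj hV hb ?_ ?_
  · exact continuousOn_const.mul (Real.continuous_exp.comp_continuousOn (continuousOn_const.mul hx))
  · intro t ht
    rw [abs_of_pos (by positivity)]
    have := le_of_abs_le (hB t ht)
    gcongr
  · intro n k hk t h0 h1
    have ht := div_two_pow_mem_Icc hk h0 h1
    have hs := div_two_pow_mem_Icc hk le_rfl (by gcongr; linarith)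
    have e1 := abs_exp_sub_exp_le (a := 4 * x t) (b := 4 * x (k / 2 ^ n)) (M := 4 * B)
      (by linarith [le_of_abs_le (hB t ht)]) (by linarith [le_of_abs_le (hB _ hs)])
    have e2 : |x t - x (k / 2 ^ n)| ≤ (K + Λ) * r ^ n := by
      have h2 := hΛ _ hs t ht
      have h3 := hw n k hk t h0 h1
      have h4 : |t - k / 2 ^ n| ≤ r ^ n := by
        rw [abs_of_nonneg (by linarith)]
        have : t - k / 2 ^ n ≤ (1 / 2) ^ n := by
          rw [add_div] at h1
          rw [div_pow, one_pow]
          linarith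
        exact this.trans (by gcongr)
      have h5 : x t - x (k / 2 ^ n) = (x t - x (k / 2 ^ n) - (w t - w (k / 2 ^ n))) +
          (w t - w (k / 2 ^ n)) := by ring
      rw [h5]
      refine (abs_add_le _ _).trans ?_
      nlinarith [mul_le_mul_of_nonneg_left h4 hΛ0]
    rw [← mul_sub, abs_mul, abs_of_pos (by norm_num : (0 : ℝ) < 4)]
    rw [← mul_sub, abs_mul, abs_of_pos (by norm_num : (0 : ℝ) < 4)] at e1
    calc 4 * |Real.exp (4 * x t) - Real.exp (4 * x (k / 2 ^ n))|
        ≤ 4 * (Real.exp (4 * B) * (4 * ((K + Λ) * r ^ n))) := by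
          have := mul_le_mul_of_nonneg_left e2 (by positivity : 0 ≤ Real.exp (4 * B) * 4)
          linarith
      _ = _ := by ring
  · intro n k
    rw [mul_pow, mul_pow, ← Real.exp_nat_mul]
    norm_num
    left
    ring_nf
  · intro n k hk
    have h1 := hC n k hk
    have h2 : (2 : ℝ) ^ (n * (H - 1 / 2)) * (2 : ℝ) ^ ((3 * (n : ℝ)) / 2 + 3) =
        (2 : ℝ) ^ (n + n * H + 3) := by
      rw [← Real.rpow_add (by norm_num)]
      congr 1
      ring
    rw [vartheta, ← mul_assoc, h2]
    refine h1.trans (mul_le_mul_of_nonneg_left ?_ hC0)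
    exact pow_le_pow_left₀ (by positivity) hrε n

/-- The integrated drift of a bounded path is Lipschitz. -/
lemma abs_sub_sub_sub_le_of_integral_eq {w x : ℝ → ℝ} {x₀ μ ρ B : ℝ}
    (hx : ContinuousOn x (Set.Icc 0 1)) (hB : ∀ t ∈ Set.Icc (0 : ℝ) 1, |x t| ≤ B)
    (h : ∀ t ∈ Set.Icc (0 : ℝ) 1, x t = x₀ + ρ * (∫ s in (0 : ℝ)..t, (μ - x s)) + w t)
    {s t : ℝ} (hs : s ∈ Set.Icc (0 : ℝ) 1) (ht : t ∈ Set.Icc (0 : ℝ) 1) :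
    |(x t - x s) - (w t - w s)| ≤ |ρ| * (|μ| + B) * |t - s| := by
  have hc : ContinuousOn (fun s => μ - x s) (Set.Icc 0 1) := continuousOn_const.sub hx
  have hi : ∀ t ∈ Set.Icc (0 : ℝ) 1,
      IntervalIntegrable (fun s => μ - x s) volume 0 t := fun t ht =>
    (hc.mono (by
      rw [Set.uIcc_of_le ht.1]
      exact Set.Icc_subset_Icc le_rfl ht.2)).intervalIntegrable
  have e : (x t - x s) - (w t - w s) = ρ * ∫ u in s..t, (μ - x u) := by
    rw [← intervalIntegral.integral_interval_sub_left (hi t ht) (hi s hs), h t ht, h s hs]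
    ring
  rw [e, abs_mul, mul_assoc]
  refine mul_le_mul_of_nonneg_left ?_ (abs_nonneg _)
  rw [← Real.norm_eq_abs]
  refine intervalIntegral.norm_integral_le_of_norm_le_const fun u hu => ?_
  have humem : u ∈ Set.Icc (0 : ℝ) 1 :=
    Set.uIcc_subset_Icc hs ht (Set.uIoc_subset_uIcc hu)
  exact (abs_sub _ _).trans (by linarith [hB u humem])

/-- Rough fractional stochastic volatility model: for the fractional Ornstein–Uhlenbeck
process `X^H_t = x₀ + ρ∫₀ᵗ(μ − X^H_s)ds + W^H_t` with `H ∈ (0,1/2)` and the integrated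
variance `Y_t = ∫₀ᵗ exp(2X^H_s) ds`, the sequential scale estimator satisfies, with
probability one, `|𝓡^s_n(Y) − H| = O(√n · 2^{-Hn/2})`.  Here `𝓡^s_n(Y)(ω)` is
`Rhat n (ηs n ω • Y(ω))` with `ηs n ω` the pathwise sequential scaling factor. -/
theorem stmt16 {Ω : Type*} [MeasurableSpace Ω] (P : Measure Ω) [IsProbabilityMeasure P]
    (H : ℝ) (hH : H ∈ Set.Ioo (0 : ℝ) (1 / 2))
    (W : ℝ → Ω → ℝ) (hW : IsFBM P H W)
    (hWsm : ∀ t, StronglyMeasurable (W t))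
    (x₀ μ ρ : ℝ) (hρ : 0 ≤ ρ)
    (X : ℝ → Ω → ℝ)
    (hXad : MeasureTheory.Adapted (MeasureTheory.Filtration.natural W hWsm) X)
    (hXc : ∀ᵐ ω ∂P, ContinuousOn (fun t => X t ω) (Set.Icc 0 1))
    (hX : ∀ᵐ ω ∂P, ∀ t ∈ Set.Icc (0 : ℝ) 1,
      X t ω = x₀ + ρ * (∫ s in (0 : ℝ)..t, (μ - X s ω)) + W t ω)
    (m : ℕ) (a : ℕ → ℝ) (ha0 : 0 < a 0) (ha : ∀ j ≤ m, 0 ≤ a j)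
    (ηs : ℕ → Ω → ℝ)
    -- `ηs n ω` is the sequential scaling factor for the path `t ↦ ∫₀ᵗ exp(2 X_s(ω)) ds`
    (hηs : ∀ᵐ ω ∂P, ∀ n, m < n → 0 < ηs n ω ∧ ∀ η : ℝ, 0 < η →
      (∑ k ∈ Finset.Icc (n - m) n, a (n - k) *
        (Rhat k (fun t => ηs n ω * ∫ s in (0 : ℝ)..t, Real.exp (2 * X s ω)) -
          Rhat (k - 1) (fun t => ηs n ω * ∫ s in (0 : ℝ)..t, Real.exp (2 * X s ω))) ^ 2) ≤
      (∑ k ∈ Finset.Icc (n - m) n, a (n - k) *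
        (Rhat k (fun t => η * ∫ s in (0 : ℝ)..t, Real.exp (2 * X s ω)) -
          Rhat (k - 1) (fun t => η * ∫ s in (0 : ℝ)..t, Real.exp (2 * X s ω))) ^ 2)) :
    ∀ᵐ ω ∂P, ∃ C : ℝ, ∀ᶠ n : ℕ in atTop,
      |Rhat n (fun t => ηs n ω * ∫ s in (0 : ℝ)..t, Real.exp (2 * X s ω)) - H| ≤
        C * (Real.sqrt n * (2 : ℝ) ^ (-(H / 2) * n)) := by
  obtain ⟨hH0, hH1⟩ := hH
  set θ : ℝ := 3 / 4 - H / 2 with hθ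
  have hθ0 : 1 / 2 < θ := by linarith
  set H' : ℝ := max (3 * H / 4) (H / (2 * θ)) with hH'
  have hH'H : H' < H := by
    refine max_lt (by linarith) ?_
    rw [div_lt_iff₀ (by linarith)]
    nlinarith
  have hH'1 : 3 * H / 4 ≤ H' := le_max_left _ _
  have hH'2 : H / 2 ≤ θ * H' := by
    have h1 : H / (2 * θ) ≤ H' := le_max_right _ _
    rw [div_le_iff₀ (by linarith)] at h1
    linarith
  set r : ℝ := (2 : ℝ) ^ (-H') with hr
  set ε : ℝ := (2 : ℝ) ^ (-(H / 2)) with hε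
  have hr0 : 0 < r := by positivity
  have hr1 : r < 1 := Real.rpow_lt_one_of_one_lt_of_neg (by norm_num) (by linarith)
  have hε0 : 0 < ε := by positivity
  have hε1 : ε < 1 := Real.rpow_lt_one_of_one_lt_of_neg (by norm_num) (by linarith)
  have hr2 : r ^ 2 = (2 : ℝ) ^ (-(2 * H')) := by
    rw [hr, ← Real.rpow_mul_natCast (by norm_num)]
    congr 1
    push_cast
    ring
  have hr2' : 1 / 2 ≤ r ^ 2 := by
    rw [hr2, show (1 / 2 : ℝ) = (2 : ℝ) ^ (-1 : ℝ) by rw [Real.rpow_neg_one]; norm_num]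
    exact Real.rpow_le_rpow_of_exponent_le (by norm_num) (by linarith)
  have hrε : (2 : ℝ) ^ H * r ^ 2 ≤ ε := by
    rw [hr2, ← Real.rpow_add (by norm_num)]
    exact Real.rpow_le_rpow_of_exponent_le (by norm_num) (by linarith)
  have hεsq : ∀ n : ℕ, ((2 : ℝ) ^ (-H)) ^ n = (ε ^ n) ^ 2 := fun n => by
    rw [← pow_mul, mul_comm, pow_mul]
    congr 1
    rw [hε, ← Real.rpow_mul_natCast (by norm_num)]
    congr 1
    push_cast
    ring
  have hεn : ∀ n : ℕ, ε ^ n = (2 : ℝ) ^ (-(H / 2) * n) := fun n => by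
    rw [hε, ← Real.rpow_mul_natCast (by norm_num)]
  set j : ℕ → ℕ := fun n => ⌊θ * n⌋₊ with hjdef
  have hjθ : ∀ n, (j n : ℝ) ≤ θ * n := fun n => Nat.floor_le (by positivity)
  have hj : ∀ n, j n ≤ n := fun n => by
    have h1 : (j n : ℝ) ≤ n := (hjθ n).trans (by
      have : (0 : ℝ) ≤ n := Nat.cast_nonneg n
      nlinarith)
    exact_mod_cast h1
  have hrj : ∀ n, r ^ j n ≤ (2 : ℝ) ^ H' * ε ^ n := fun n => by
    rw [hεn, hr, ← Real.rpow_mul_natCast (by norm_num), ← Real.rpow_add (by norm_num)]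
    refine Real.rpow_le_rpow_of_exponent_le (by norm_num) ?_
    have h1 : θ * n < j n + 1 := Nat.lt_floor_add_one _
    have h2 : (0 : ℝ) ≤ n := Nat.cast_nonneg n
    have h3 : H' * (θ * n) ≤ H' * (j n + 1) := mul_le_mul_of_nonneg_left h1.le (by linarith)
    have h4 := mul_le_mul_of_nonneg_right hH'2 h2
    linarith
  obtain ⟨τ, hτ0, hτ⟩ := exists_quarterForm_limit (p := 2 * H) (by linarith) (by linarith)
  have hV : ∀ n : ℕ, |-32 * quarterForm (fun x => |x| ^ (2 * H)) (2 ^ n) 0 - 32 * τ| ≤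
      32 * ε ^ n := fun n => by
    have h1 := hτ (2 ^ n) (by positivity)
    have h2 : (1 / (4 * 2 ^ n : ℕ) : ℝ) ^ (2 * H) ≤ ε ^ n := by
      have h3 : (1 / (4 * 2 ^ n : ℕ) : ℝ) ≤ (2 : ℝ) ^ (-(n : ℝ)) := by
        rw [Real.rpow_neg (by norm_num), Real.rpow_natCast, one_div]
        push_cast
        gcongr
        have : (0 : ℝ) < 2 ^ n := by positivity
        linarith
      refine (Real.rpow_le_rpow (by positivity) h3 (by linarith)).trans ?_
      rw [← Real.rpow_mul (by norm_num), hεn]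
      refine Real.rpow_le_rpow_of_exponent_le (by norm_num) ?_
      have h2 : (0 : ℝ) ≤ n := Nat.cast_nonneg n
      nlinarith
    rw [show -32 * quarterForm (fun x => |x| ^ (2 * H)) (2 ^ n) 0 - 32 * τ =
      -32 * (quarterForm (fun x => |x| ^ (2 * H)) (2 ^ n) 0 + τ) by ring, abs_mul, abs_neg,
      abs_of_pos (by norm_num : (0 : ℝ) < 32)]
    exact mul_le_mul_of_nonneg_left (h1.trans h2) (by norm_num)
  filter_upwards [hXc, hX, hηs, hW.2.1, hW.ae_dyadic_increment_le hH0 hH'H,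
    hW.ae_blockVar_le ⟨hH0, hH1⟩ (by linarith : θ < 1 - H) j hj hjθ]
    with ω hxc hxe hη hwc ⟨K, hK⟩ ⟨Kb, hKb⟩
  obtain ⟨B, hB⟩ := isCompact_Icc.exists_bound_of_continuousOn hxc
  simp only [Real.norm_eq_abs] at hB
  obtain ⟨C, hC⟩ := exists_energy_sub_le hε0 hε1.le hr2' hr0 hr1.le hrε hxc hB
    (fun n k hk t h0 h1 => abs_sub_dyadic_le hwc hr0 hr1 hK hk h0 h1)
    (fun s hs t ht => abs_sub_sub_sub_le_of_integral_eq hxc hB hxe hs ht) hj hrj hV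
    (fun n => (hKb n).trans_eq (by rw [hεsq]))
  have hσ : 0 < 32 * τ * ∫ t in (0 : ℝ)..1, 4 * Real.exp (4 * X t ω) := by
    refine mul_pos (by positivity) (intervalIntegral.intervalIntegral_pos_of_pos_on ?_
      (fun t _ => by positivity) zero_lt_one)
    refine ContinuousOn.intervalIntegrable ?_
    rw [Set.uIcc_of_le zero_le_one]
    exact continuousOn_const.mul
      (Real.continuous_exp.comp_continuousOn (continuousOn_const.mul hxc))
  obtain ⟨c, C', δ, N, hC'0, hR⟩ := exists_Rhat_const_mul_eq hσ hε0 hε1 hC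
  obtain ⟨D, hD⟩ := exists_abs_sequential_sub_le
    (F := fun k η => Rhat k (fun t => η * ∫ s in (0 : ℝ)..t, Real.exp (2 * X s ω)))
    hC'0 hε0 hε1 ha0 ha hR hη
  refine ⟨|D|, ?_⟩
  filter_upwards [hD, eventually_ge_atTop 1] with n hn hn1
  refine hn.trans ?_
  rw [hεn]
  have h1 : (1 : ℝ) ≤ Real.sqrt n := Real.one_le_sqrt.2 (by exact_mod_cast hn1)
  have h2 : (0 : ℝ) < (2 : ℝ) ^ (-(H / 2) * n) := by positivity
  exact mul_le_mul (le_abs_self D) (le_mul_of_one_le_left h2.le h1) h2.le (abs_nonneg D)
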